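/- arXiv:1712.02176 — 4 statements merged into one kernel-verified Lean document; each statement's English description precedes it below -/
import Mathlib

section
/- Let A ⊆ [0,1]^d be an up-closed 0/1-polytope and B ⊆ [0,1]^d a convex set with A ⊆ B and d' := dim(A) = dim(B) (affine dimension). If d' = 1, then A = B. Otherwise: (i) rdist(A,B) ≥ (1/(d'−1)) · LPgapMin(A,B)/(1 + LPgapMin(A,B)), and (ii) LPgapMin(A,B) ≥ rdist(A,B)/(d' − 1 − rdist(A,B)). -/
open scoped ENNReal Pointwise

/-- The relative distance between two sets `A ⊆ B ⊆ ℝ^ι`: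
`rdist(A,B) = sup_{π linear} d_H(π(A),π(B)) / diam(π(A))`, computed in `ℝ≥0∞`,
so that a fraction with `∞` in the denominator as well as `0/0` is `0`,
`rdist(∅,∅) = 0` and `rdist(∅,B) = ∞` for `B ≠ ∅`. -/
noncomputable def relDist {ι : Type*} (A B : Set (ι → ℝ)) : ℝ≥0∞ :=
  ⨆ π : (ι → ℝ) →ₗ[ℝ] ℝ,
    (⨆ b ∈ B, ⨅ a ∈ A, ENNReal.ofReal |π b - π a|) /
      (⨆ a ∈ A, ⨆ a' ∈ A, ENNReal.ofReal |π a - π a'|)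

/-- The minimization gap between non-empty convex sets `A ⊆ B ⊆ ℝ^d_{≥0}`:
`inf { ε ≥ 0 : ∀ c ≥ 0, inf_{a ∈ A} cᵀa ≤ (1+ε)·inf_{b ∈ B} cᵀb }`. -/
noncomputable def LPgapMin {d : ℕ} (A B : Set (Fin d → ℝ)) : ℝ≥0∞ :=
  ⨅ ε ∈ {e : ℝ | 0 ≤ e ∧ ∀ c : Fin d → ℝ, (∀ i, 0 ≤ c i) →
      sInf ((fun a => ∑ i, c i * a i) '' A) ≤ (1 + e) * sInf ((fun b => ∑ i, c i * b i) '' B)},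
    ENNReal.ofReal ε
theorem relDist_self {ι : Type*} (A : Set (ι → ℝ)) : relDist A A = 0 := by
  refine le_antisymm (iSup_le fun π => ?_) bot_le
  have h : (⨆ b ∈ A, ⨅ a ∈ A, ENNReal.ofReal |π b - π a|) ≤ 0 :=
    iSup₂_le fun b hb => (iInf₂_le b hb).trans (by simp)
  rw [le_antisymm h bot_le, ENNReal.zero_div]

theorem LPgapMin_self {d : ℕ} (A : Set (Fin d → ℝ)) : LPgapMin A A = 0 := by
  refine le_antisymm ((iInf₂_le (0 : ℝ) ?_).trans (by simp)) bot_le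
  exact ⟨le_rfl, fun c _ => by simp⟩

theorem isLinearMap_sum_mul {d : ℕ} (c : Fin d → ℝ) :
    IsLinearMap ℝ (fun x : Fin d → ℝ => ∑ i, c i * x i) :=
  ⟨fun x y => by simp [mul_add, Finset.sum_add_distrib],
    fun t x => by simp only [Pi.smul_apply, smul_eq_mul, Finset.mul_sum]
                  exact Finset.sum_congr rfl fun i _ => by ring⟩

theorem le_sum_mul_of_mem_convexHull {d : ℕ} {V : Set (Fin d → ℝ)} {c : Fin d → ℝ} {m : ℝ}
    (h : ∀ v ∈ V, m ≤ ∑ i, c i * v i) {a : Fin d → ℝ} (ha : a ∈ convexHull ℝ V) :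
    m ≤ ∑ i, c i * a i :=
  convexHull_min (show V ⊆ {x | m ≤ ∑ i, c i * x i} from h)
    (convex_halfSpace_ge (isLinearMap_sum_mul c) m) ha

theorem finite_of_zero_or_one {d : ℕ} {V : Set (Fin d → ℝ)}
    (hV : ∀ v ∈ V, ∀ i, v i = 0 ∨ v i = 1) : V.Finite :=
  (Set.Finite.pi' (t := fun _ : Fin d => ({0, 1} : Set ℝ)) fun _ => by simp).subset
    fun v hv i => by simpa using hV v hv i

/-- The vector all of whose entries are `1`, except for the entry `0` at `i`. -/
def coatom {d : ℕ} (i : Fin d) : Fin d → ℝ := fun j => if j = i then 0 else 1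

open Classical in
/-- The coordinates that are not constantly `1` on an up-closed `0/1`-polytope `A`. -/
noncomputable def freeCoords {d : ℕ} (A : Set (Fin d → ℝ)) : Finset (Fin d) :=
  Finset.univ.filter fun i => coatom i ∈ A

theorem mem_freeCoords {d : ℕ} {A : Set (Fin d → ℝ)} {i : Fin d} :
    i ∈ freeCoords A ↔ coatom i ∈ A := by
  simp [freeCoords]

theorem sum_freeCoords_mul {d : ℕ} (s : Finset (Fin d)) (c x : Fin d → ℝ) :
    ∑ i, (if i ∈ s then c i else 0) * x i = ∑ i ∈ s, c i * x i := by
  simp [ite_mul, Finset.sum_ite_mem]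

section UpClosed

variable {d : ℕ} {A V : Set (Fin d → ℝ)}

theorem apply_eq_one_of_notMem_freeCoords
    (hV : ∀ v ∈ V, ∀ i, v i = 0 ∨ v i = 1) (hA : A = convexHull ℝ V)
    (hAup : ∀ x ∈ A, ∀ y : Fin d → ℝ, (∀ i, x i ≤ y i) → (∀ i, y i ≤ 1) → y ∈ A)
    {i : Fin d} (hi : i ∉ freeCoords A) {a : Fin d → ℝ} (ha : a ∈ A) : a i = 1 := by
  have key : ∀ v ∈ V, v i = 1 := by
    intro v hv
    refine (hV v hv i).resolve_left fun h0 => hi (mem_freeCoords.2 ?_)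
    refine hAup v (hA ▸ subset_convexHull ℝ V hv) _ (fun j => ?_) (fun j => ?_)
    · unfold coatom
      split_ifs with h
      · rw [h, h0]
      · rcases hV v hv j with h | h <;> rw [h]; exact zero_le_one
    · unfold coatom
      split_ifs <;> norm_num
  rw [hA] at ha
  exact convexHull_min (show V ⊆ {x | x i = 1} from key)
    (convex_hyperplane (LinearMap.proj (R := ℝ) (φ := fun _ : Fin d => ℝ) i).isLinear 1) ha

theorem direction_affineSpan_eq_span
    (hone : (1 : Fin d → ℝ) ∈ A)
    (hfix : ∀ i ∉ freeCoords A, ∀ a ∈ A, a i = 1) :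
    (affineSpan ℝ A).direction =
      Submodule.span ℝ (Set.range fun i : freeCoords A => (Pi.single (i : Fin d) (1 : ℝ))) := by
  rw [direction_affineSpan]
  apply le_antisymm
  · rw [vectorSpan_def, Submodule.span_le]
    rintro _ ⟨a, ha, a', ha', rfl⟩
    have : a -ᵥ a' = ∑ i ∈ freeCoords A, (a i - a' i) • (Pi.single i (1 : ℝ) : Fin d → ℝ) := by
      ext j
      simp only [vsub_eq_sub, Pi.sub_apply, Finset.sum_apply, Pi.smul_apply, smul_eq_mul,
        Pi.single_apply, mul_ite, mul_one, mul_zero, Finset.sum_ite_eq]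
      split_ifs with h
      · rfl
      · rw [hfix j h a ha, hfix j h a' ha', sub_self]
    change a -ᵥ a' ∈ Submodule.span ℝ _
    rw [this]
    exact Submodule.sum_mem _ fun i hi =>
      Submodule.smul_mem _ _ (Submodule.subset_span ⟨⟨i, hi⟩, rfl⟩)
  · rw [Submodule.span_le]
    rintro _ ⟨⟨i, hi⟩, rfl⟩
    have h : (Pi.single i 1 : Fin d → ℝ) = 1 -ᵥ coatom i := by
      ext j
      by_cases h : j = i <;> simp [coatom, h]
    change (Pi.single i 1 : Fin d → ℝ) ∈ vectorSpan ℝ A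
    rw [h]
    exact vsub_mem_vectorSpan ℝ hone (mem_freeCoords.1 hi)

theorem finrank_direction_eq_card_freeCoords
    (hone : (1 : Fin d → ℝ) ∈ A)
    (hfix : ∀ i ∉ freeCoords A, ∀ a ∈ A, a i = 1) :
    Module.finrank ℝ (affineSpan ℝ A).direction = (freeCoords A).card := by
  rw [direction_affineSpan_eq_span hone hfix, finrank_span_eq_card]
  · simp
  · have := (Pi.basisFun ℝ (Fin d)).linearIndependent.comp
      (fun i : freeCoords A => (i : Fin d)) Subtype.val_injective
    simpa only [Function.comp_def, Pi.basisFun_apply] using this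

theorem apply_eq_one_of_finrank_eq {B : Set (Fin d → ℝ)}
    (hone : (1 : Fin d → ℝ) ∈ A)
    (hfix : ∀ i ∉ freeCoords A, ∀ a ∈ A, a i = 1) (hAB : A ⊆ B)
    (hdim : Module.finrank ℝ (affineSpan ℝ A).direction =
      Module.finrank ℝ (affineSpan ℝ B).direction)
    {i : Fin d} (hi : i ∉ freeCoords A) {b : Fin d → ℝ} (hb : b ∈ B) : b i = 1 := by
  have hdir := Submodule.eq_of_le_of_finrank_eq
    (AffineSubspace.direction_le (affineSpan_mono ℝ hAB)) hdim
  have hmem : b -ᵥ (1 : Fin d → ℝ) ∈ (affineSpan ℝ A).direction := by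
    rw [hdir, direction_affineSpan]
    exact vsub_mem_vectorSpan ℝ hb (hAB hone)
  have hle : (affineSpan ℝ A).direction ≤
      LinearMap.ker (LinearMap.proj (R := ℝ) (φ := fun _ : Fin d => ℝ) i) := by
    rw [direction_affineSpan, vectorSpan_def, Submodule.span_le]
    rintro _ ⟨a, ha, a', ha', rfl⟩
    simp [hfix i hi a ha, hfix i hi a' ha']
  have := hle hmem
  simp only [LinearMap.mem_ker, LinearMap.proj_apply, vsub_eq_sub, Pi.sub_apply,
    Pi.one_apply] at this
  linarith

theorem sum_mul_sub_le_of_gap {B : Set (Fin d → ℝ)} (hVne : V.Nonempty)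
    (hV : ∀ v ∈ V, ∀ i, v i = 0 ∨ v i = 1) (hA : A = convexHull ℝ V)
    (hAup : ∀ x ∈ A, ∀ y : Fin d → ℝ, (∀ i, x i ≤ y i) → (∀ i, y i ≤ 1) → y ∈ A)
    (hBcube : B ⊆ {x | ∀ i, 0 ≤ x i ∧ x i ≤ 1})
    (hfix : ∀ i ∉ freeCoords A, ∀ a ∈ A, a i = 1)
    (hfixB : ∀ i ∉ freeCoords A, ∀ b ∈ B, b i = 1)
    {k : ℕ} (hk : (freeCoords A).card = k + 1) {e : ℝ} (he0 : 0 ≤ e)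
    (he : ∀ c : Fin d → ℝ, (∀ i, 0 ≤ c i) →
      sInf ((fun a => ∑ i, c i * a i) '' A) ≤ (1 + e) * sInf ((fun b => ∑ i, c i * b i) '' B))
    (c : Fin d → ℝ) {D : ℝ} (hD : ∀ i ∈ freeCoords A, |c i| ≤ D) {b : Fin d → ℝ} (hb : b ∈ B) :
    ∃ a ∈ A, ∑ i, c i * a i - ∑ i, c i * b i ≤ k * e / (1 + e) * D := by
  classical
  set p : Fin d → ℝ := fun i => if i ∈ freeCoords A then max (c i) 0 else 0 with hp
  have hp0 : ∀ i, 0 ≤ p i := fun i => by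
    simp only [hp]; split_ifs <;> simp
  obtain ⟨x, hxV, hx⟩ := Set.exists_min_image V (fun v => ∑ i, p i * v i)
    (finite_of_zero_or_one hV) hVne
  have hxA : x ∈ A := hA ▸ subset_convexHull ℝ V hxV
  have hmin : ∀ a ∈ A, ∑ i, p i * x i ≤ ∑ i, p i * a i := fun a ha =>
    le_sum_mul_of_mem_convexHull hx (hA ▸ ha)
  have hgap : ∑ i, p i * x i ≤ (1 + e) * ∑ i, p i * b i := by
    refine le_trans (b := sInf ((fun a => ∑ i, p i * a i) '' A))
      (le_csInf ⟨_, x, hxA, rfl⟩ ?_) ((he p hp0).trans ?_)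
    · rintro _ ⟨a, ha, rfl⟩
      exact hmin a ha
    · refine mul_le_mul_of_nonneg_left (csInf_le ⟨0, ?_⟩ (Set.mem_image_of_mem _ hb)) (by linarith)
      rintro _ ⟨y, hy, rfl⟩
      exact Finset.sum_nonneg fun i _ => mul_nonneg (hp0 i) (hBcube hy i).1
  have hm : ∑ i, p i * x i ≤ k * D := by
    obtain ⟨j, hj⟩ : (freeCoords A).Nonempty := Finset.card_pos.1 (by omega)
    refine (hmin _ (mem_freeCoords.1 hj)).trans ?_
    have hcard : ((freeCoords A).erase j).card = k := by
      rw [Finset.card_erase_of_mem hj, hk]; rfl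
    calc ∑ i, p i * coatom j i = ∑ i ∈ freeCoords A, max (c i) 0 * coatom j i :=
          sum_freeCoords_mul _ (fun i => max (c i) 0) _
      _ = ∑ i ∈ (freeCoords A).erase j, max (c i) 0 * coatom j i :=
          (Finset.sum_erase _ (by simp [coatom])).symm
      _ ≤ ∑ i ∈ (freeCoords A).erase j, D := by
          refine Finset.sum_le_sum fun i hi => ?_
          rw [Finset.mem_erase] at hi
          have := hD i hi.2
          simp only [coatom, hi.1, if_false, mul_one]
          exact max_le ((le_abs_self _).trans this) ((abs_nonneg _).trans this)
      _ = k * D := by rw [Finset.sum_const, hcard, nsmul_eq_mul]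
  have hx1 : ∀ i, x i ≤ 1 := fun i => by
    rcases hV x hxV i with h | h <;> rw [h]; exact zero_le_one
  refine ⟨fun i => if c i < 0 then 1 else x i, hAup x hxA _ (fun i => ?_) (fun i => ?_), ?_⟩
  · split_ifs; exacts [hx1 i, le_rfl]
  · split_ifs; exacts [le_rfl, hx1 i]
  have hsum : ∑ i, c i * (if c i < 0 then 1 else x i) - ∑ i, c i * b i ≤
      ∑ i, p i * x i - ∑ i, p i * b i := by
    rw [← Finset.sum_sub_distrib, ← Finset.sum_sub_distrib]
    refine Finset.sum_le_sum fun i _ => ?_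
    by_cases hi : i ∈ freeCoords A
    · simp only [hp, hi, if_true]
      split_ifs with h
      · rw [max_eq_right h.le]
        nlinarith [(hBcube hb i).2]
      · rw [max_eq_left (not_lt.1 h)]
    · simp [hp, hi, hfix i hi x hxA, hfixB i hi b hb]
  refine hsum.trans ?_
  have h1e : 0 < 1 + e := by linarith
  have h2 : (∑ i, p i * x i) * (e / (1 + e)) ≤ k * D * (e / (1 + e)) :=
    mul_le_mul_of_nonneg_right hm (by positivity)
  have h3 : (∑ i, p i * x i) / (1 + e) ≤ ∑ i, p i * b i := by
    rw [div_le_iff₀ h1e]; linarith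
  have h4 : (∑ i, p i * x i) - (∑ i, p i * x i) / (1 + e) =
      (∑ i, p i * x i) * (e / (1 + e)) := by field_simp; ring
  have h5 : k * e / (1 + e) * D = k * D * (e / (1 + e)) := by ring
  linarith

theorem relDist_le_of_gap {B : Set (Fin d → ℝ)} (hVne : V.Nonempty)
    (hV : ∀ v ∈ V, ∀ i, v i = 0 ∨ v i = 1) (hA : A = convexHull ℝ V)
    (hAup : ∀ x ∈ A, ∀ y : Fin d → ℝ, (∀ i, x i ≤ y i) → (∀ i, y i ≤ 1) → y ∈ A)
    (hBcube : B ⊆ {x | ∀ i, 0 ≤ x i ∧ x i ≤ 1}) (hAB : A ⊆ B)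
    (hone : (1 : Fin d → ℝ) ∈ A)
    (hfix : ∀ i ∉ freeCoords A, ∀ a ∈ A, a i = 1)
    (hfixB : ∀ i ∉ freeCoords A, ∀ b ∈ B, b i = 1)
    {k : ℕ} (hk : (freeCoords A).card = k + 1) {e : ℝ} (he0 : 0 ≤ e)
    (he : ∀ c : Fin d → ℝ, (∀ i, 0 ≤ c i) →
      sInf ((fun a => ∑ i, c i * a i) '' A) ≤ (1 + e) * sInf ((fun b => ∑ i, c i * b i) '' B)) :
    relDist A B ≤ ENNReal.ofReal (k * e / (1 + e)) := by
  refine iSup_le fun π => ENNReal.div_le_of_le_mul ?_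
  set c : Fin d → ℝ := fun i => π (Pi.single i 1) with hc
  have hπ : ∀ x, π x = ∑ i, c i * x i := fun x => by
    rw [LinearMap.pi_apply_eq_sum_univ π x]
    refine Finset.sum_congr rfl fun i _ => ?_
    rw [smul_eq_mul, mul_comm, hc]
    congr 2
    ext j
    simp [Pi.single_apply, eq_comm]
  have hbound : ∀ x ∈ B, |π x| ≤ ∑ i, |c i| := fun x hx => by
    rw [hπ]
    refine (Finset.abs_sum_le_sum_abs _ _).trans (Finset.sum_le_sum fun i _ => ?_)
    rw [abs_mul, abs_of_nonneg (hBcube hx i).1]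
    exact mul_le_of_le_one_right (abs_nonneg _) (hBcube hx i).2
  set Δ : ℝ≥0∞ := ⨆ a ∈ A, ⨆ a' ∈ A, ENNReal.ofReal |π a - π a'| with hΔ
  have hΔtop : Δ ≠ ∞ := by
    refine ne_top_of_le_ne_top (ENNReal.ofReal_ne_top (r := 2 * ∑ i, |c i|)) ?_
    refine iSup₂_le fun a ha => iSup₂_le fun a' ha' => ENNReal.ofReal_le_ofReal ?_
    have h1 := abs_le.1 (hbound a (hAB ha))
    have h2 := abs_le.1 (hbound a' (hAB ha'))
    exact abs_le.2 ⟨by linarith, by linarith⟩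
  have hD : ∀ i ∈ freeCoords A, |c i| ≤ Δ.toReal := fun i hi => by
    rw [← ENNReal.ofReal_le_iff_le_toReal hΔtop]
    have h : c i = π 1 - π (coatom i) := by
      rw [← map_sub, hc]
      dsimp only
      congr 1
      ext j
      by_cases h : j = i <;> simp [coatom, h]
    rw [h]
    exact le_iSup₂_of_le 1 hone (le_iSup₂_of_le (coatom i) (mem_freeCoords.1 hi) le_rfl)
  set K : ℝ := k * e / (1 + e) with hK
  have hK0 : 0 ≤ K := by positivity
  refine iSup₂_le fun b hb => ?_
  obtain ⟨a₁, ha₁, h₁⟩ := sum_mul_sub_le_of_gap hVne hV hA hAup hBcube hfix hfixB hk he0 he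
    c hD hb
  obtain ⟨a₂, ha₂, h₂⟩ := sum_mul_sub_le_of_gap hVne hV hA hAup hBcube hfix hfixB hk he0 he
    (fun i => -c i) (fun i hi => by rw [abs_neg]; exact hD i hi) hb
  simp only [neg_mul, Finset.sum_neg_distrib] at h₂
  rw [← hπ, ← hπ] at h₁ h₂
  obtain ⟨a, ha, hab⟩ : ∃ a ∈ A, |π b - π a| ≤ K * Δ.toReal := by
    by_cases h : π b - K * Δ.toReal ≤ π a₁
    · exact ⟨a₁, ha₁, abs_le.2 ⟨by linarith, by linarith⟩⟩
    · have hconv : Convex ℝ (π '' A) := (hA ▸ convex_convexHull ℝ V : Convex ℝ A).linear_image π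
      obtain ⟨a, ha, hπa⟩ := hconv.ordConnected.out ⟨a₁, ha₁, rfl⟩ ⟨a₂, ha₂, rfl⟩
        (⟨(not_le.1 h).le, by linarith⟩ : π b - K * Δ.toReal ∈ Set.Icc (π a₁) (π a₂))
      refine ⟨a, ha, ?_⟩
      rw [hπa, sub_sub_cancel, abs_of_nonneg (by positivity)]
  refine (iInf₂_le a ha).trans ((ENNReal.ofReal_le_ofReal hab).trans ?_)
  rw [ENNReal.ofReal_mul hK0, ENNReal.ofReal_toReal hΔtop]

theorem sum_mul_le_of_relDist {B : Set (Fin d → ℝ)} (hVne : V.Nonempty)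
    (hV : ∀ v ∈ V, ∀ i, v i = 0 ∨ v i = 1) (hA : A = convexHull ℝ V)
    (hBcube : B ⊆ {x | ∀ i, 0 ≤ x i ∧ x i ≤ 1}) (hAB : A ⊆ B)
    (hfix : ∀ i ∉ freeCoords A, ∀ a ∈ A, a i = 1)
    (hfixB : ∀ i ∉ freeCoords A, ∀ b ∈ B, b i = 1)
    {k : ℕ} (hk : (freeCoords A).card = k + 1) {ρ : ℝ} (hρ0 : 0 ≤ ρ)
    (hρ : relDist A B ≤ ENNReal.ofReal ρ)
    {c : Fin d → ℝ} (hc : ∀ i, 0 ≤ c i) :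
    ∃ x ∈ A, ∀ b ∈ B, (1 - k * ρ) * ∑ i, c i * x i ≤ ∑ i, c i * b i := by
  classical
  obtain ⟨x, hxV, hx⟩ := Set.exists_min_image V (fun v => ∑ i ∈ freeCoords A, c i * v i)
    (finite_of_zero_or_one hV) hVne
  have hxA : x ∈ A := hA ▸ subset_convexHull ℝ V hxV
  refine ⟨x, hxA, fun b hb => ?_⟩
  set α : ℝ := ∑ i ∈ freeCoords A, c i * x i with hα
  have hα0 : 0 ≤ α := Finset.sum_nonneg fun i _ => mul_nonneg (hc i) (hBcube (hAB hxA) i).1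
  set q : Fin d → ℝ := fun i => if i ∈ freeCoords A then min (c i) α else 0 with hq
  have hqsum : ∀ y : Fin d → ℝ, ∑ i, q i * y i = ∑ i ∈ freeCoords A, min (c i) α * y i :=
    fun y => sum_freeCoords_mul _ (fun i => min (c i) α) y
  have hqV : ∀ v ∈ V, α ≤ ∑ i, q i * v i := fun v hv => by
    have hv0 : ∀ i, 0 ≤ v i := fun i => by rcases hV v hv i with h | h <;> simp [h]
    rw [hqsum]
    by_cases h : ∃ i ∈ freeCoords A, v i = 1 ∧ α ≤ c i
    · obtain ⟨i, hi, hvi, hci⟩ := h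
      calc α = min (c i) α * v i := by rw [hvi, mul_one, min_eq_right hci]
        _ ≤ _ := Finset.single_le_sum (f := fun i => min (c i) α * v i)
          (fun j _ => mul_nonneg (le_min (hc j) hα0) (hv0 j)) hi
    · push Not at h
      refine (hx v hv).trans (Finset.sum_le_sum fun i hi => ?_)
      rcases hV v hv i with h0 | h1
      · simp [h0]
      · rw [min_eq_left (h i hi h1).le]
  have hqA : ∀ a ∈ A, α ≤ ∑ i, q i * a i := fun a ha =>
    le_sum_mul_of_mem_convexHull hqV (hA ▸ ha)
  have hqtop : ∀ a ∈ A, ∑ i, q i * a i ≤ (k + 1) * α := fun a ha => by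
    rw [hqsum]
    calc ∑ i ∈ freeCoords A, min (c i) α * a i ≤ ∑ i ∈ freeCoords A, α := by
          refine Finset.sum_le_sum fun i _ => ?_
          have := hBcube (hAB ha) i
          exact (mul_le_mul_of_nonneg_right (min_le_right _ _) this.1).trans
            (mul_le_of_le_one_right hα0 this.2)
      _ = (k + 1) * α := by rw [Finset.sum_const, hk, nsmul_eq_mul]; push_cast; ring
  have hqb : ∑ i, q i * b i ≤ ∑ i ∈ freeCoords A, c i * b i := by
    rw [hqsum]
    exact Finset.sum_le_sum fun i _ =>
      mul_le_mul_of_nonneg_right (min_le_left _ _) (hBcube hb i).1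
  have hfrac := (le_iSup (fun π : (Fin d → ℝ) →ₗ[ℝ] ℝ =>
    (⨆ b ∈ B, ⨅ a ∈ A, ENNReal.ofReal |π b - π a|) /
      (⨆ a ∈ A, ⨆ a' ∈ A, ENNReal.ofReal |π a - π a'|))
      (IsLinearMap.mk' _ (isLinearMap_sum_mul q))).trans hρ
  simp only [IsLinearMap.mk'_apply] at hfrac
  have hdiam : (⨆ a ∈ A, ⨆ a' ∈ A, ENNReal.ofReal |∑ i, q i * a i - ∑ i, q i * a' i|) ≤
      ENNReal.ofReal (k * α) :=
    iSup₂_le fun a ha => iSup₂_le fun a' ha' => ENNReal.ofReal_le_ofReal <| abs_le.2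
      ⟨by linarith [hqA a ha, hqtop a' ha'], by linarith [hqA a' ha', hqtop a ha]⟩
  rw [ENNReal.div_le_iff_le_mul (Or.inr ENNReal.ofReal_ne_top)
    (Or.inl (ne_top_of_le_ne_top ENNReal.ofReal_ne_top hdiam))] at hfrac
  have hdist : ENNReal.ofReal (α - ∑ i, q i * b i) ≤ ENNReal.ofReal (ρ * (k * α)) := by
    rw [ENNReal.ofReal_mul hρ0]
    refine le_trans ?_ (hfrac.trans (mul_le_mul_right hdiam _))
    refine le_iSup₂_of_le b hb (le_iInf₂ fun a ha => ENNReal.ofReal_le_ofReal ?_)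
    rw [abs_sub_comm]
    exact (sub_le_sub_right (hqA a ha) _).trans (le_abs_self _)
  rw [ENNReal.ofReal_le_ofReal_iff (by positivity)] at hdist
  have hsplit : ∀ y : Fin d → ℝ, (∀ i ∉ freeCoords A, y i = 1) →
      ∑ i, c i * y i = ∑ i ∈ freeCoords A, c i * y i + ∑ i ∈ (freeCoords A)ᶜ, c i := fun y hy => by
    rw [← Finset.sum_add_sum_compl (freeCoords A)]
    congr 1
    exact Finset.sum_congr rfl fun i hi => by rw [hy i (Finset.mem_compl.1 hi), mul_one]
  rw [hsplit x fun i hi => hfix i hi x hxA, hsplit b fun i hi => hfixB i hi b hb, ← hα]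
  have hrest : 0 ≤ ∑ i ∈ (freeCoords A)ᶜ, c i := Finset.sum_nonneg fun i _ => hc i
  have : 0 ≤ k * ρ * ∑ i ∈ (freeCoords A)ᶜ, c i := by positivity
  nlinarith

theorem LPgapMin_le_of_relDist {B : Set (Fin d → ℝ)} (hVne : V.Nonempty)
    (hV : ∀ v ∈ V, ∀ i, v i = 0 ∨ v i = 1) (hA : A = convexHull ℝ V)
    (hBcube : B ⊆ {x | ∀ i, 0 ≤ x i ∧ x i ≤ 1}) (hAB : A ⊆ B)
    (hfix : ∀ i ∉ freeCoords A, ∀ a ∈ A, a i = 1)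
    (hfixB : ∀ i ∉ freeCoords A, ∀ b ∈ B, b i = 1)
    {k : ℕ} (hk : (freeCoords A).card = k + 1) {ρ : ℝ} (hρ0 : 0 ≤ ρ) (hρ1 : k * ρ < 1)
    (hρ : relDist A B ≤ ENNReal.ofReal ρ) :
    LPgapMin A B ≤ ENNReal.ofReal ((1 - k * ρ)⁻¹ - 1) := by
  have hpos : 0 < 1 - k * ρ := by linarith
  have hkρ : 0 ≤ k * ρ := by positivity
  refine iInf₂_le _ ⟨?_, fun c hc => ?_⟩
  · rw [sub_nonneg, one_le_inv₀ hpos]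
    linarith
  obtain ⟨x, hxA, hx⟩ := sum_mul_le_of_relDist hVne hV hA hBcube hAB hfix hfixB hk hρ0 hρ hc
  have hlow : sInf ((fun a => ∑ i, c i * a i) '' A) ≤ ∑ i, c i * x i := by
    refine csInf_le ⟨0, ?_⟩ ⟨x, hxA, rfl⟩
    rintro _ ⟨y, hy, rfl⟩
    exact Finset.sum_nonneg fun i _ => mul_nonneg (hc i) (hBcube (hAB hy) i).1
  have hup : (1 - k * ρ) * ∑ i, c i * x i ≤ sInf ((fun b => ∑ i, c i * b i) '' B) := by
    refine le_csInf ⟨_, x, hAB hxA, rfl⟩ ?_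
    rintro _ ⟨b, hb, rfl⟩
    exact hx b hb
  rw [add_sub_cancel, inv_mul_eq_div, le_div_iff₀' hpos]
  exact (mul_le_mul_of_nonneg_left hlow hpos.le).trans hup

end UpClosed

theorem one_sub_one_div_one_add_le {k : ℕ} (hk : 1 ≤ k) {L r : ℝ≥0∞}
    (h : ∀ ρ : ℝ, 0 ≤ ρ → k * ρ < 1 → r ≤ ENNReal.ofReal ρ →
      L ≤ ENNReal.ofReal ((1 - k * ρ)⁻¹ - 1)) :
    1 / (k : ℝ≥0∞) * (1 - 1 / (1 + L)) ≤ r := by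
  have hk0 : (k : ℝ≥0∞) ≠ 0 := by exact_mod_cast (by omega : k ≠ 0)
  have hkr : (0 : ℝ) < k := by exact_mod_cast hk
  rw [one_div, ENNReal.inv_mul_le_iff hk0 (ENNReal.natCast_ne_top k)]
  by_cases h1 : 1 ≤ (k : ℝ≥0∞) * r
  · exact tsub_le_self.trans h1
  rw [not_le] at h1
  have hr : r ≠ ∞ := by
    rintro rfl
    simp [ENNReal.mul_top hk0] at h1
  have hkρ : (k : ℝ) * r.toReal < 1 := by
    have := (ENNReal.toReal_lt_toReal h1.ne_top ENNReal.one_ne_top).2 h1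
    simpa using this
  have hpos : 0 < 1 - k * r.toReal := by linarith
  have hinv : 1 ≤ (1 - k * r.toReal)⁻¹ := by
    rw [one_le_inv₀ hpos]
    nlinarith [r.toReal_nonneg]
  have hL := h r.toReal ENNReal.toReal_nonneg hkρ (ENNReal.ofReal_toReal hr).ge
  have h1L : 1 + L ≤ ENNReal.ofReal (1 - k * r.toReal)⁻¹ := by
    refine (add_le_add_right hL 1).trans ?_
    rw [← ENNReal.ofReal_one, ← ENNReal.ofReal_add zero_le_one (by linarith), add_sub_cancel]
  have hfrac : ENNReal.ofReal (1 - k * r.toReal) ≤ 1 / (1 + L) := by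
    rw [one_div, ENNReal.le_inv_iff_le_inv, ← ENNReal.ofReal_inv_of_pos hpos]
    exact h1L
  rw [tsub_le_iff_right]
  calc (1 : ℝ≥0∞) = ENNReal.ofReal (k * r.toReal) + ENNReal.ofReal (1 - k * r.toReal) := by
        rw [← ENNReal.ofReal_add (by positivity) hpos.le]; simp
    _ ≤ _ := by
        refine add_le_add (le_of_eq ?_) hfrac
        rw [ENNReal.ofReal_mul hkr.le, ENNReal.ofReal_toReal hr, ENNReal.ofReal_natCast]

theorem div_sub_le_of_le {k : ℕ} (hk : 1 ≤ k) {e : ℝ} (he : 0 ≤ e) {r : ℝ≥0∞}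
    (h : r ≤ ENNReal.ofReal (k * e / (1 + e))) :
    r / ((k : ℝ≥0∞) - r) ≤ ENNReal.ofReal e := by
  have hkr : (0 : ℝ) < k := by exact_mod_cast hk
  have hsub : ENNReal.ofReal (k / (1 + e)) ≤ (k : ℝ≥0∞) - r := by
    refine le_trans (le_of_eq ?_) (tsub_le_tsub_left h _)
    rw [← ENNReal.ofReal_natCast k, ← ENNReal.ofReal_sub _ (by positivity)]
    congr 1
    field_simp
    ring
  refine ENNReal.div_le_of_le_mul (h.trans ?_)
  refine le_trans (le_of_eq ?_) (mul_le_mul_right hsub _)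
  rw [← ENNReal.ofReal_mul he]
  congr 1
  ring

/-- Let `A ⊆ [0,1]^d` be an up-closed `0/1`-polytope and `B ⊆ [0,1]^d` a
convex set with `A ⊆ B` and `d' := dim A = dim B`.  If `d' = 1` then `A = B`; otherwise
`rdist(A,B) ≥ (1/(d'-1)) · LPgapMin(A,B)/(1 + LPgapMin(A,B))` and
`LPgapMin(A,B) ≥ rdist(A,B)/(d' - 1 - rdist(A,B))` (note that in `ℝ≥0∞` one has
`L/(1+L) = 1 - 1/(1+L)`, the latter form also being correct for `L = ∞`). -/
theorem relDist_vs_LPgapMin (d : ℕ) (A B : Set (Fin d → ℝ))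
    (hA01 : ∃ V : Set (Fin d → ℝ), V.Nonempty ∧ (∀ v ∈ V, ∀ i, v i = 0 ∨ v i = 1) ∧
      A = convexHull ℝ V)
    (hAup : ∀ x ∈ A, ∀ y : Fin d → ℝ, (∀ i, x i ≤ y i) → (∀ i, y i ≤ 1) → y ∈ A)
    (hB : Convex ℝ B) (hBcube : B ⊆ {x | ∀ i, 0 ≤ x i ∧ x i ≤ 1}) (hAB : A ⊆ B)
    (d' : ℕ) (hdimA : d' = Module.finrank ℝ (affineSpan ℝ A).direction)
    (hdimB : d' = Module.finrank ℝ (affineSpan ℝ B).direction) :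
    (d' = 1 → A = B) ∧
    (d' ≠ 1 →
      (1 / ((d' : ℝ≥0∞) - 1)) * (1 - 1 / (1 + LPgapMin A B)) ≤ relDist A B ∧
      relDist A B / (((d' : ℝ≥0∞) - 1) - relDist A B) ≤ LPgapMin A B) := by
  obtain ⟨V, hVne, hV, hA⟩ := hA01
  have hone : (1 : Fin d → ℝ) ∈ A := by
    obtain ⟨v, hv⟩ := hVne
    have hvA : v ∈ A := hA ▸ subset_convexHull ℝ V hv
    exact hAup v hvA _ (fun i => (hBcube (hAB hvA) i).2) fun i => le_rfl
  have hfix : ∀ i ∉ freeCoords A, ∀ a ∈ A, a i = 1 := fun i hi a ha =>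
    apply_eq_one_of_notMem_freeCoords hV hA hAup hi ha
  have hfixB : ∀ i ∉ freeCoords A, ∀ b ∈ B, b i = 1 := fun i hi b hb =>
    apply_eq_one_of_finrank_eq hone hfix hAB (hdimA.symm.trans hdimB) hi hb
  have hcard : (freeCoords A).card = d' := by
    rw [hdimA, finrank_direction_eq_card_freeCoords hone hfix]
  have heq : d' ≤ 1 → A = B := by
    intro hd
    refine hAB.antisymm fun b hb => ?_
    rcases (freeCoords A).eq_empty_or_nonempty with hS | ⟨i, hi⟩
    · exact hAup 1 hone b (fun j => (hfixB j (by simp [hS]) b hb).ge) fun j => (hBcube hb j).2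
    · refine hAup _ (mem_freeCoords.1 hi) b (fun j => ?_) fun j => (hBcube hb j).2
      unfold coatom
      split_ifs with h
      · exact (hBcube hb j).1
      · exact (hfixB j (fun hj => h (Finset.card_le_one.1 (hcard.trans_le hd) j hj i hi)) b hb).ge
  refine ⟨fun hd => heq hd.le, fun hd => ?_⟩
  by_cases hd1 : d' ≤ 1
  · rw [heq hd1, relDist_self, LPgapMin_self]
    simp
  obtain ⟨k, rfl⟩ : ∃ k, d' = k + 1 := ⟨d' - 1, by omega⟩
  have hk : 1 ≤ k := by omega
  have hcast : ((k + 1 : ℕ) : ℝ≥0∞) - 1 = k := by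
    push_cast
    exact ENNReal.add_sub_cancel_right ENNReal.one_ne_top
  rw [hcast]
  refine ⟨one_sub_one_div_one_add_le hk fun ρ hρ0 hρ1 hρ => ?_, le_iInf₂ fun e he => ?_⟩
  · exact LPgapMin_le_of_relDist hVne hV hA hBcube hAB hfix hfixB hcard hρ0 hρ1 hρ
  · exact div_sub_le_of_le hk he.1
      (relDist_le_of_gap hVne hV hA hAup hBcube hAB hone hfix hfixB hcard he.1 he.2)
end

section
/- Let A, B ⊆ [0,1]^d be convex sets with ∅ ≠ A ⊆ B. Then the Hausdorff distance with respect to the Euclidean norm satisfies d_H(A,B) ≤ √d · rdist(A,B)/(1 + rdist(A,B)), where for rdist(A,B) = ∞ the right-hand side is interpreted as √d. -/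
open scoped ENNReal Pointwise

/-- The Hausdorff distance between `A, B ⊆ ℝ^d` with respect to the Euclidean norm,
in `ℝ≥0∞`. -/
noncomputable def hausdorffEuclid {d : ℕ} (A B : Set (Fin d → ℝ)) : ℝ≥0∞ :=
  max (⨆ a ∈ A, ⨅ b ∈ B, ENNReal.ofReal (Real.sqrt (∑ i, (a i - b i) ^ 2)))
      (⨆ b ∈ B, ⨅ a ∈ A, ENNReal.ofReal (Real.sqrt (∑ i, (a i - b i) ^ 2)))

/-- A point at positive distance from a non-empty convex set is separated from it, along some unit
direction, by at least that distance. -/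
theorem Convex.exists_unit_infDist_le_inner {E : Type*} [NormedAddCommGroup E]
    [InnerProductSpace ℝ E] [CompleteSpace E] {s : Set E} (hs : Convex ℝ s) (hne : s.Nonempty)
    {b : E} (hb : 0 < Metric.infDist b s) :
    ∃ v : E, ‖v‖ = 1 ∧ ∀ a ∈ s, Metric.infDist b s ≤ inner ℝ v (b - a) := by
  obtain ⟨p, hp, hpmin⟩ := exists_norm_eq_iInf_of_complete_convex hne.closure
    isClosed_closure.isComplete hs.closure b
  have hinner := (norm_eq_iInf_iff_real_inner_le_zero hs.closure hp).1 hpmin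
  have hle : Metric.infDist b s ≤ ‖b - p‖ := by
    rw [← Metric.infDist_closure, ← dist_eq_norm]
    exact Metric.infDist_le_dist_of_mem hp
  have hpos : 0 < ‖b - p‖ := hb.trans_le hle
  refine ⟨‖b - p‖⁻¹ • (b - p), ?_, fun a ha ↦ hle.trans ?_⟩
  · rw [norm_smul, norm_inv, norm_norm, inv_mul_cancel₀ hpos.ne']
  · have h := hinner a (subset_closure ha)
    have hdecomp : b - a = (b - p) - (a - p) := by abel
    rw [real_inner_smul_left, hdecomp, inner_sub_right, real_inner_self_eq_norm_sq,
      ← div_eq_inv_mul, le_div_iff₀ hpos]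
    nlinarith

theorem norm_toLp_sub_le_sqrt_of_mem_cube {d : ℕ} {x y : Fin d → ℝ}
    (hx : ∀ i, 0 ≤ x i ∧ x i ≤ 1) (hy : ∀ i, 0 ≤ y i ∧ y i ≤ 1) :
    ‖WithLp.toLp 2 x - WithLp.toLp 2 y‖ ≤ √(d : ℝ) := by
  rw [EuclideanSpace.norm_eq]
  apply Real.sqrt_le_sqrt
  calc ∑ i, ‖(WithLp.toLp 2 x - WithLp.toLp 2 y) i‖ ^ 2 ≤ ∑ _i : Fin d, (1 : ℝ) := by
        refine Finset.sum_le_sum fun i _ ↦ ?_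
        simp only [PiLp.sub_apply, Real.norm_eq_abs, sq_abs]
        nlinarith [hx i, hy i]
    _ = d := by simp

theorem iInf_ofReal_sqrt_eq_infEDist {d : ℕ} (A : Set (Fin d → ℝ)) (b : Fin d → ℝ) :
    ⨅ a ∈ A, ENNReal.ofReal (√(∑ i, (a i - b i) ^ 2)) =
      Metric.infEDist (WithLp.toLp 2 b) (WithLp.toLp 2 '' A) := by
  rw [Metric.infEDist, iInf_image]
  refine iInf_congr fun a ↦ iInf_congr fun _ ↦ ?_
  rw [edist_comm, edist_dist, EuclideanSpace.dist_eq]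
  simp [Real.dist_eq, sq_abs]

theorem div_le_relDist {ι : Type*} {A B : Set (ι → ℝ)} (π : (ι → ℝ) →ₗ[ℝ] ℝ) {b : ι → ℝ}
    (hb : b ∈ B) {δ w : ℝ≥0∞} (hδ : ∀ a ∈ A, δ ≤ ENNReal.ofReal |π b - π a|)
    (hw : ∀ a ∈ A, ∀ a' ∈ A, ENNReal.ofReal |π a - π a'| ≤ w) :
    δ / w ≤ relDist A B :=
  (ENNReal.div_le_div ((le_iInf₂ hδ).trans
    (le_iSup₂ (f := fun b (_ : b ∈ B) ↦ ⨅ a ∈ A, ENNReal.ofReal |π b - π a|) b hb))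
    (iSup₂_le fun a ha ↦ iSup₂_le fun a' ha' ↦ hw a ha a' ha')).trans
    (le_iSup (fun π : (ι → ℝ) →ₗ[ℝ] ℝ ↦
      (⨆ b ∈ B, ⨅ a ∈ A, ENNReal.ofReal |π b - π a|) /
        (⨆ a ∈ A, ⨆ a' ∈ A, ENNReal.ofReal |π a - π a'|)) π)

theorem ENNReal.le_add_mul_one_sub_one_div_one_add {e f r : ℝ≥0∞} (he : e ≠ 0) (he' : e ≠ ∞)
    (hf : f ≠ ∞) (hr : e / f ≤ r) : e ≤ (e + f) * (1 - 1 / (1 + r)) := by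
  have hs : e + f ≠ 0 := by simp [he]
  have hs' : e + f ≠ ∞ := by simp [he', hf]
  have h : 1 / (1 + r) ≤ f / (e + f) := by
    rcases eq_or_ne f 0 with rfl | hf0
    · have : r = ∞ := by simpa [ENNReal.div_zero he] using hr
      simp [this]
    · calc 1 / (1 + r) ≤ 1 / (1 + e / f) := by gcongr
        _ = f / (e + f) := by
          rw [one_div, ← ENNReal.inv_div (Or.inl hf) (Or.inl hf0), ENNReal.add_div,
            ENNReal.div_self hf0 hf, add_comm]
  calc e = (e + f) - f := (ENNReal.add_sub_cancel_right hf).symm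
    _ = (e + f) * (1 - f / (e + f)) := by
      rw [ENNReal.mul_sub fun _ _ ↦ hs', mul_one, ENNReal.mul_div_cancel hs hs']
    _ ≤ _ := by gcongr

/-- For convex sets `∅ ≠ A ⊆ B ⊆ [0,1]^d`,
`d_H(A,B) ≤ √d · rdist(A,B)/(1 + rdist(A,B))`; here the right-hand side is written as
`√d · (1 - 1/(1 + rdist(A,B)))`, which equals `√d` when `rdist(A,B) = ∞`. -/
theorem hausdorff_le_sqrt_mul_relDist (d : ℕ) (A B : Set (Fin d → ℝ))
    (hA : Convex ℝ A) (hB : Convex ℝ B)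
    (hAcube : A ⊆ {x | ∀ i, 0 ≤ x i ∧ x i ≤ 1}) (hBcube : B ⊆ {x | ∀ i, 0 ≤ x i ∧ x i ≤ 1})
    (hAne : A.Nonempty) (hAB : A ⊆ B) :
    hausdorffEuclid A B ≤
      ENNReal.ofReal (Real.sqrt d) * (1 - 1 / (1 + relDist A B)) := by
  refine max_le (iSup₂_le fun a ha ↦ (iInf₂_le a (hAB ha)).trans (by simp))
    (iSup₂_le fun b hb ↦ ?_)
  rw [iInf_ofReal_sqrt_eq_infEDist]
  set A' : Set (EuclideanSpace ℝ (Fin d)) := WithLp.toLp 2 '' A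
  have hA'ne : A'.Nonempty := hAne.image _
  have hA' : Convex ℝ A' :=
    hA.linear_image (WithLp.linearEquiv 2 ℝ (Fin d → ℝ)).symm.toLinearMap
  have htop := Metric.infEDist_ne_top (x := WithLp.toLp 2 b) hA'ne
  rcases eq_or_ne (Metric.infEDist (WithLp.toLp 2 b) A') 0 with h0 | h0
  · simp [h0]
  set δ := Metric.infDist (WithLp.toLp 2 b) A'
  have hδpos : 0 < δ := ENNReal.toReal_pos h0 htop
  have hδeq : Metric.infEDist (WithLp.toLp 2 b) A' = ENNReal.ofReal δ :=
    (ENNReal.ofReal_toReal htop).symm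
  obtain ⟨v, hv, hsep⟩ := hA'.exists_unit_infDist_le_inner hA'ne hδpos
  let π : (Fin d → ℝ) →ₗ[ℝ] ℝ :=
    (innerₗ (EuclideanSpace ℝ (Fin d)) v) ∘ₗ
      (WithLp.linearEquiv 2 ℝ (Fin d → ℝ)).symm.toLinearMap
  have hπ (x y) : π x - π y = inner ℝ v (WithLp.toLp 2 x - WithLp.toLp 2 y) := by
    rw [inner_sub_right]; rfl
  have hlower (a) (ha : a ∈ A) : δ ≤ π b - π a :=
    (hsep _ (Set.mem_image_of_mem _ ha)).trans_eq (hπ b a).symm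
  have hupper (a) (ha : a ∈ A) : π b - π a ≤ √(d : ℝ) := by
    rw [hπ]
    refine (real_inner_le_norm _ _).trans ?_
    rw [hv, one_mul]
    exact norm_toLp_sub_le_sqrt_of_mem_cube (hBcube hb) (hAcube ha)
  have hδd : δ ≤ √(d : ℝ) := by
    obtain ⟨a, ha⟩ := hAne
    exact (hlower a ha).trans (hupper a ha)
  have hr : ENNReal.ofReal δ / ENNReal.ofReal (√(d : ℝ) - δ) ≤ relDist A B := by
    refine div_le_relDist π hb
      (fun a ha ↦ ENNReal.ofReal_le_ofReal ((hlower a ha).trans (le_abs_self _)))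
      (fun a ha a' ha' ↦ ENNReal.ofReal_le_ofReal (abs_le.2 ⟨?_, ?_⟩)) <;>
    linarith [hlower a ha, hupper a ha, hlower a' ha', hupper a' ha']
  have hsum : ENNReal.ofReal (√(d : ℝ)) =
      ENNReal.ofReal δ + ENNReal.ofReal (√(d : ℝ) - δ) := by
    rw [← ENNReal.ofReal_add hδpos.le (sub_nonneg.2 hδd), add_sub_cancel]
  rw [hδeq, hsum]
  exact ENNReal.le_add_mul_one_sub_one_div_one_add (by simpa using hδpos) ENNReal.ofReal_ne_top
    ENNReal.ofReal_ne_top hr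
end

section
/- Let α, β, γ, ε > 0 be constants with ε < α and ε < γ. There exists a constant κ > 0 (depending only on α, β, γ, ε) such that for every integer n ≥ 2 the following holds: if C is a non-empty convex set (in some ℝ^d) that does not admit an (α/n^β)-LEF of size at most 2^{γ·n}, then every ((α−ε)/n^β)-MILEF of C of size at most 2^{(γ−ε)·n} has at least κ·n/log n integer variables. -/
open scoped ENNReal Pointwise

/-- A point of `ℝ^k` all of whose coordinates are integers. -/
def IsLatticePoint {k : ℕ} (z : Fin k → ℝ) : Prop := ∀ i, ∃ n : ℤ, z i = (n : ℝ)

/-- `Q` is a polyhedron given as the intersection of an affine subspace with at most `m`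
closed halfspaces (`m` serving as the number of facets). -/
def IsPolyhedronOfSize {ι : Type*} (Q : Set (ι → ℝ)) (m : ℕ) : Prop :=
  ∃ (S : AffineSubspace ℝ (ι → ℝ)) (nh : ℕ), nh ≤ m ∧
    ∃ (f : Fin nh → ((ι → ℝ) →ₗ[ℝ] ℝ)) (b : Fin nh → ℝ),
      Q = (S : Set (ι → ℝ)) ∩ {x | ∀ i, f i x ≤ b i}

/-- `Q` is a polyhedron. -/
def IsPolyhedron {ι : Type*} (Q : Set (ι → ℝ)) : Prop := ∃ m, IsPolyhedronOfSize Q m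

/-- `C` admits an `ε`-LEF of size `m`: a polyhedron `Q ⊆ ℝ^ℓ` with at most `m` facets
and an affine map `π` with `C ⊆ π(Q)` and `rdist(C, π(Q)) ≤ ε`. -/
def IsLEF {ι : Type*} (C : Set (ι → ℝ)) (ε : ℝ) (m : ℕ) : Prop :=
  ∃ (l : ℕ) (Q : Set (Fin l → ℝ)) (π : (Fin l → ℝ) →ᵃ[ℝ] (ι → ℝ)),
    IsPolyhedronOfSize Q m ∧ C ⊆ π '' Q ∧ relDist C (π '' Q) ≤ ENNReal.ofReal ε

/-- `C` admits an `ε`-MILEF of complexity `(m, k)`: a polyhedron `Q ⊆ ℝ^ℓ` with at most `m`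
facets together with affine maps `σ : ℝ^ℓ → ℝ^k` and `π : ℝ^ℓ → ℝ^ι` such that
`C̄ := conv(π(Q ∩ σ⁻¹(ℤ^k)))` satisfies `C ⊆ C̄` and `rdist(C, C̄) ≤ ε`. -/
def IsMILEF {ι : Type*} (C : Set (ι → ℝ)) (ε : ℝ) (m k : ℕ) : Prop :=
  ∃ (l : ℕ) (Q : Set (Fin l → ℝ)) (σ : (Fin l → ℝ) →ᵃ[ℝ] (Fin k → ℝ))
    (π : (Fin l → ℝ) →ᵃ[ℝ] (ι → ℝ)),
    IsPolyhedronOfSize Q m ∧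
    C ⊆ convexHull ℝ (π '' (Q ∩ {x | IsLatticePoint (σ x)})) ∧
    relDist C (convexHull ℝ (π '' (Q ∩ {x | IsLatticePoint (σ x)}))) ≤ ENNReal.ofReal ε

/-- Minkowski's theorem on linear forms. -/
theorem exists_ne_zero_int_abs_mulVec_le {j : ℕ} (A : Matrix (Fin j) (Fin j) ℝ) (hA : A.det ≠ 0)
    {r : ℝ} (hr : 0 < r) (h : |A.det| < r ^ j) :
    ∃ v : Fin j → ℤ, v ≠ 0 ∧ ∀ i, |(A.mulVec fun k => (v k : ℝ)) i| ≤ r := by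
  classical
  let b := Pi.basisFun ℝ (Fin j)
  have fund := ZSpan.isAddFundamentalDomain' b (MeasureTheory.volume)
  have hdet : LinearMap.det (Matrix.toLin' A) = A.det := LinearMap.det_toLin' A
  have hvol : MeasureTheory.volume ((Matrix.toLin' A) ⁻¹' Metric.ball (0 : Fin j → ℝ) r)
      = ENNReal.ofReal |A.det⁻¹| * ENNReal.ofReal ((2 * r) ^ j) := by
    rw [MeasureTheory.Measure.addHaar_preimage_linearMap _ (by rwa [hdet]), hdet,
      Real.volume_pi_ball _ hr, Fintype.card_fin]
  have : Countable (Submodule.span ℤ (Set.range b)).toAddSubgroup :=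
    inferInstanceAs (Countable (Submodule.span ℤ (Set.range b)))
  obtain ⟨x, hx0, hx⟩ :=
    MeasureTheory.exists_ne_zero_mem_lattice_of_measure_mul_two_pow_lt_measure
      (μ := MeasureTheory.volume)
      (s := (Matrix.toLin' A) ⁻¹' Metric.ball (0 : Fin j → ℝ) r) fund
      (fun x hx => by simpa [Matrix.mulVec_neg] using hx) ((convex_ball _ _).linear_preimage _) (by
        rw [hvol, ZSpan.volume_fundamentalDomain, Module.finrank_fin_fun,
          ← ENNReal.ofReal_mul (abs_nonneg _)]
        have h1 : (Matrix.of (b : Fin j → Fin j → ℝ)).det = 1 := by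
          have : (Matrix.of (b : Fin j → Fin j → ℝ)) = 1 := by
            ext i k; simp [b, Matrix.one_apply, Pi.single_apply, eq_comm]
          rw [this, Matrix.det_one]
        rw [h1, abs_one, ENNReal.ofReal_one, one_mul,
          show (2 : ℝ≥0∞) ^ j = ENNReal.ofReal (2 ^ j) by
            rw [ENNReal.ofReal_pow (by norm_num)]; simp]
        have hp : 0 < |A.det| := abs_pos.mpr hA
        apply (ENNReal.ofReal_lt_ofReal_iff (by positivity)).mpr
        rw [abs_inv, mul_pow, ← div_eq_inv_mul, lt_div_iff₀ hp]
        exact mul_lt_mul_of_pos_left h (by positivity))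
  have hmem : (x : Fin j → ℝ) ∈ Submodule.span ℤ (Set.range b) := x.2
  rw [b.mem_span_iff_repr_mem ℤ] at hmem
  choose v hv using hmem
  have hv' : (fun k => (v k : ℝ)) = (x : Fin j → ℝ) := by
    funext k; simpa [b] using hv k
  refine ⟨v, ?_, fun i => ?_⟩
  · rintro rfl
    apply hx0
    ext k
    simpa using (congrFun hv' k).symm
  · rw [hv']
    have := mem_ball_zero_iff.mp hx
    rw [Matrix.toLin'_apply] at this
    exact (norm_le_pi_norm (A.mulVec (x : Fin j → ℝ)) i).trans this.le

/-- A lattice without short nonzero dual vectors has a short nonzero vector. -/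
theorem exists_short_vector_of_no_short_dual {E : Type*} [NormedAddCommGroup E]
    [InnerProductSpace ℝ E] {j : ℕ} (hj : 0 < j) (b : Fin j → E) (hb : LinearIndependent ℝ b)
    {Λ : ℝ} (hΛ : 0 < Λ)
    (hdual : ∀ u : Fin j → ℤ,
      (∀ x : Fin j → ℝ, |∑ i, (u i : ℝ) * x i| ≤ Λ * ‖∑ i, x i • b i‖) → u = 0) :
    ∃ v : Fin j → ℤ, v ≠ 0 ∧ ‖∑ i, (v i : ℝ) • b i‖ ≤ 2 * j ^ 2 / Λ := by
  classical
  have hj' : (0 : ℝ) < j := by exact_mod_cast hj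
  let W := Submodule.span ℝ (Set.range b)
  have hfin : Module.finrank ℝ W = j := by simpa using finrank_span_eq_card hb
  have : FiniteDimensional ℝ W := FiniteDimensional.span_of_finite ℝ (Set.finite_range b)
  let o : OrthonormalBasis (Fin j) ℝ W := (stdOrthonormalBasis ℝ W).reindex (finCongr hfin)
  let b' : Fin j → W := fun k => ⟨b k, Submodule.subset_span ⟨k, rfl⟩⟩
  let A : Matrix (Fin j) (Fin j) ℝ := Matrix.of fun i k => o.repr (b' k) i
  have hrepr : ∀ x : Fin j → ℝ, ∀ i, A.mulVec x i = o.repr (∑ k, x k • b' k) i := by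
    intro x i
    simp [A, Matrix.mulVec, dotProduct, mul_comm]
  have hnorm : ∀ x : Fin j → ℝ, ‖∑ k, x k • b k‖ = ‖o.repr (∑ k, x k • b' k)‖ := by
    intro x
    rw [LinearIsometryEquiv.norm_map]
    exact congrArg norm (by simp [b'] : _ = ((∑ k, x k • b' k : W) : E))
  have hcoord : ∀ x : Fin j → ℝ, ∀ i, |A.mulVec x i| ≤ ‖∑ k, x k • b k‖ := by
    intro x i
    rw [hrepr, hnorm]
    exact PiLp.norm_apply_le (o.repr (∑ k, x k • b' k)) i
  have hsum : ∀ x : Fin j → ℝ, ‖∑ k, x k • b k‖ ≤ ∑ i, |A.mulVec x i| := by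
    intro x
    have h0 := Finset.sum_congr rfl fun i (_ : i ∈ Finset.univ) => congrArg abs (hrepr x i)
    rw [h0, hnorm, EuclideanSpace.norm_eq, Real.sqrt_le_left (by positivity)]
    simp only [Real.norm_eq_abs]
    exact Finset.sum_sq_le_sq_sum_of_nonneg fun i _ => abs_nonneg _
  have hA : A.det ≠ 0 := by
    intro h0
    obtain ⟨x, hx0, hx⟩ := Matrix.exists_mulVec_eq_zero_iff.mpr h0
    apply hx0
    have h1 := hsum x
    simp only [hx, Pi.zero_apply, abs_zero, Finset.sum_const_zero] at h1
    funext i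
    exact Fintype.linearIndependent_iff.mp hb x (norm_le_zero_iff.mp h1) i
  by_cases hcase : |(A⁻¹).transpose.det| < (Λ / j) ^ j
  · exfalso
    have hdet0 : (A⁻¹).transpose.det ≠ 0 := by
      rw [Matrix.det_transpose, Matrix.det_nonsing_inv]
      simpa using hA
    obtain ⟨u, hu0, hu⟩ := exists_ne_zero_int_abs_mulVec_le _ hdet0 (by positivity) hcase
    refine hu0 (hdual u fun x => ?_)
    have hux : ∑ i, (u i : ℝ) * x i
        = ∑ i, ((A⁻¹).transpose.mulVec fun k => (u k : ℝ)) i * A.mulVec x i := by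
      change (fun k => (u k : ℝ)) ⬝ᵥ x = ((A⁻¹).transpose.mulVec fun k => (u k : ℝ)) ⬝ᵥ A.mulVec x
      rw [Matrix.mulVec_transpose, ← Matrix.dotProduct_mulVec, Matrix.mulVec_mulVec,
        Matrix.nonsing_inv_mul _ (isUnit_iff_ne_zero.mpr hA), Matrix.one_mulVec]
    rw [hux]
    calc |∑ i, ((A⁻¹).transpose.mulVec fun k => (u k : ℝ)) i * A.mulVec x i|
        ≤ ∑ i, |((A⁻¹).transpose.mulVec fun k => (u k : ℝ)) i * A.mulVec x i| :=
          Finset.abs_sum_le_sum_abs _ _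
      _ ≤ ∑ _i : Fin j, Λ / j * ‖∑ k, x k • b k‖ := by
          refine Finset.sum_le_sum fun i _ => ?_
          rw [abs_mul]
          exact mul_le_mul (hu i) (hcoord x i) (abs_nonneg _) (by positivity)
      _ = Λ * ‖∑ k, x k • b k‖ := by
          simp only [Finset.sum_const, Finset.card_univ, Fintype.card_fin, nsmul_eq_mul]
          field_simp
  · rw [Matrix.det_transpose, Matrix.det_nonsing_inv, Ring.inverse_eq_inv', abs_inv,
      not_lt] at hcase
    have hp : 0 < |A.det| := abs_pos.mpr hA
    have h1 : |A.det| < (2 * j / Λ) ^ j := by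
      calc |A.det| ≤ ((Λ / j) ^ j)⁻¹ := (le_inv_comm₀ (by positivity) hp).mp hcase
        _ = (j / Λ) ^ j := by rw [← inv_pow, inv_div]
        _ < (2 * j / Λ) ^ j := by
          apply pow_lt_pow_left₀ _ (by positivity) hj.ne'
          gcongr
          linarith
    obtain ⟨v, hv0, hv⟩ := exists_ne_zero_int_abs_mulVec_le A hA (by positivity) h1
    refine ⟨v, hv0, (hsum _).trans ?_⟩
    calc ∑ i, |A.mulVec (fun k => (v k : ℝ)) i| ≤ ∑ _i : Fin j, 2 * j / Λ :=
          Finset.sum_le_sum fun i _ => hv i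
      _ = 2 * j ^ 2 / Λ := by
          simp only [Finset.sum_const, Finset.card_univ, Fintype.card_fin, nsmul_eq_mul]
          ring

/-- Every nonzero integer vector is a multiple of a member of some lattice basis. -/
theorem exists_intBasis_smul_zero_eq {j : ℕ} {v : Fin (j + 1) → ℤ} (hv : v ≠ 0) :
    ∃ (B : Module.Basis (Fin (j + 1)) ℤ (Fin (j + 1) → ℤ)) (a : ℤ), v = a • B 0 := by
  obtain ⟨n, bM, bN, f, a, snf⟩ :=
    Submodule.smithNormalForm (Pi.basisFun ℤ (Fin (j + 1))) (Submodule.span ℤ {v})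
  have hvN : v ∈ Submodule.span ℤ {v} := Submodule.mem_span_singleton_self v
  have hn : 0 < n := by
    rcases Nat.eq_zero_or_pos n with rfl | h
    · have := bN.ext_elem_iff (x := ⟨v, hvN⟩) (y := 0)
      exact absurd (congrArg Subtype.val (this.mpr fun i => i.elim0)) hv
    · exact h
  let i₀ : Fin n := ⟨0, hn⟩
  obtain ⟨m, hm⟩ := Submodule.mem_span_singleton.mp (bN i₀).2
  have hm0 : m ≠ 0 := by
    rintro rfl
    exact bN.ne_zero i₀ (Subtype.ext (by rw [← hm]; simp))
  have key : ∀ i, i ≠ f i₀ → bM.repr v i = 0 := by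
    intro i hi
    have h1 : bM.repr (m • v) i = bM.repr (a i₀ • bM (f i₀)) i := by rw [hm, snf]
    rw [map_smul, map_smul, bM.repr_self] at h1
    simpa [hm0, Finsupp.single_apply, hi.symm] using h1
  refine ⟨bM.reindex (Equiv.swap (f i₀) 0), bM.repr v (f i₀), ?_⟩
  rw [Module.Basis.reindex_apply, Equiv.symm_swap, Equiv.swap_apply_right]
  conv_lhs => rw [← bM.sum_repr v]
  exact Finset.sum_eq_single _ (fun i _ hi => by rw [key i hi, zero_smul]) (by simp)

/-- The transference bound: if the dual lattice has no nonzero vector of norm at most `Λ`, then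
the covering radius is at most `j ^ 3 / Λ`. -/
theorem exists_int_norm_sub_le {E : Type*} [NormedAddCommGroup E] [InnerProductSpace ℝ E]
    {j : ℕ} (b : Fin j → E) (hb : LinearIndependent ℝ b) {Λ : ℝ} (hΛ : 0 < Λ)
    (hdual : ∀ u : Fin j → ℤ,
      (∀ x : Fin j → ℝ, |∑ i, (u i : ℝ) * x i| ≤ Λ * ‖∑ i, x i • b i‖) → u = 0)
    (x : Fin j → ℝ) :
    ∃ z : Fin j → ℤ, ‖∑ i, (x i - z i) • b i‖ ≤ j ^ 3 / Λ := by
  induction j with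
  | zero => exact ⟨0, by simp⟩
  | succ j ih =>
    -- It suffices to treat families whose first member is short.
    have main : ∀ b : Fin (j + 1) → E, LinearIndependent ℝ b →
        (∀ u : Fin (j + 1) → ℤ,
          (∀ x : Fin (j + 1) → ℝ, |∑ i, (u i : ℝ) * x i| ≤ Λ * ‖∑ i, x i • b i‖) → u = 0) →
        ‖b 0‖ ≤ 2 * ((j + 1 : ℕ) : ℝ) ^ 2 / Λ →
        ∀ x : Fin (j + 1) → ℝ,
          ∃ z : Fin (j + 1) → ℤ, ‖∑ i, (x i - z i) • b i‖ ≤ ((j + 1 : ℕ) : ℝ) ^ 3 / Λ := by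
      intro b hb hdual h0 x
      let p := (ℝ ∙ b 0)ᗮ.starProjection
      have hp : ∀ w, ∃ s : ℝ, w = p w + s • b 0 := by
        intro w
        have h1 := (ℝ ∙ b 0).starProjection_add_starProjection_orthogonal w
        obtain ⟨s, hs⟩ := Submodule.mem_span_singleton.mp
          ((ℝ ∙ b 0).starProjection_apply_mem w)
        exact ⟨s, by rw [hs, add_comm]; exact h1.symm⟩
      have hp_norm : ∀ w, ‖p w‖ ≤ ‖w‖ := fun w => Submodule.norm_starProjection_apply_le _ w
      have hp0 : p (b 0) = 0 :=
        Submodule.starProjection_orthogonal_apply_eq_zero (Submodule.mem_span_singleton_self _)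
      have hpsum : ∀ y : Fin j → ℝ, ∑ i, y i • p (b i.succ) = p (∑ i, y i • b i.succ) := by
        intro y; simp [map_sum]
      have hind : LinearIndependent ℝ fun i : Fin j => p (b i.succ) := by
        rw [Fintype.linearIndependent_iff]
        intro c hc i
        rw [hpsum] at hc
        obtain ⟨s, hs⟩ := hp (∑ i, c i • b i.succ)
        have h1 := Fintype.linearIndependent_iff.mp hb (Fin.cons (-s) c) (by
          rw [Fin.sum_univ_succ]
          simp only [Fin.cons_zero, Fin.cons_succ]
          rw [hs, hc]; simp) i.succ
        simpa using h1
      obtain ⟨z', hz'⟩ := ih (fun i => p (b i.succ)) hind (fun u hu => by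
        have h1 := hdual (Fin.cons 0 u) (fun y => by
          have h2 := hu (fun i => y i.succ)
          rw [hpsum] at h2
          have h3 : p (∑ i : Fin j, y i.succ • b i.succ) = p (∑ i, y i • b i) := by
            rw [Fin.sum_univ_succ (fun i => y i • b i), map_add, map_smul, hp0]; simp
          rw [h3] at h2
          rw [Fin.sum_univ_succ]
          simp only [Fin.cons_zero, Fin.cons_succ, Int.cast_zero, zero_mul, zero_add]
          exact h2.trans (mul_le_mul_of_nonneg_left (hp_norm _) hΛ.le))
        funext i
        simpa using congrFun h1 i.succ) (fun i => x i.succ)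
      rw [hpsum] at hz'
      obtain ⟨s, hs⟩ := hp (∑ i : Fin j, (x i.succ - z' i) • b i.succ)
      refine ⟨Fin.cons (round (x 0 + s)) z', ?_⟩
      rw [Fin.sum_univ_succ]
      simp only [Fin.cons_zero, Fin.cons_succ]
      rw [hs]
      have h4 : |x 0 + s - round (x 0 + s)| ≤ 1 / 2 := abs_sub_round _
      calc ‖(x 0 - (round (x 0 + s) : ℤ)) • b 0
              + (p (∑ i : Fin j, (x i.succ - z' i) • b i.succ) + s • b 0)‖
          = ‖p (∑ i : Fin j, (x i.succ - z' i) • b i.succ)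
              + (x 0 + s - (round (x 0 + s) : ℤ)) • b 0‖ := by congr 1; module
        _ ≤ (j : ℝ) ^ 3 / Λ + 1 / 2 * (2 * ((j + 1 : ℕ) : ℝ) ^ 2 / Λ) := by
          refine (norm_add_le _ _).trans (add_le_add hz' ?_)
          rw [norm_smul, Real.norm_eq_abs]
          exact mul_le_mul h4 h0 (norm_nonneg _) (by norm_num)
        _ = ((j : ℝ) ^ 3 + ((j + 1 : ℕ) : ℝ) ^ 2) / Λ := by ring
        _ ≤ ((j + 1 : ℕ) : ℝ) ^ 3 / Λ := by
          gcongr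
          push_cast
          nlinarith [sq_nonneg (j : ℝ), (Nat.cast_nonneg j : (0 : ℝ) ≤ j)]
    obtain ⟨v, hv0, hv⟩ := exists_short_vector_of_no_short_dual j.succ_pos b hb hΛ hdual
    obtain ⟨B, a, hvB⟩ := exists_intBasis_smul_zero_eq hv0
    let e := Pi.basisFun ℤ (Fin (j + 1))
    let P : Matrix (Fin (j + 1)) (Fin (j + 1)) ℝ := (e.toMatrix B).map (Int.castRingHom ℝ)
    let R : Matrix (Fin (j + 1)) (Fin (j + 1)) ℝ := (B.toMatrix e).map (Int.castRingHom ℝ)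
    have hPR : P * R = 1 := by
      rw [← Matrix.map_mul, Module.Basis.toMatrix_mul_toMatrix_flip]; simp
    have hRP : R * P = 1 := by
      rw [← Matrix.map_mul, Module.Basis.toMatrix_mul_toMatrix_flip]; simp
    have hP : ∀ k i, P k i = B i k := by
      intro k i; simp [P, e, Module.Basis.toMatrix_apply]
    let b' : Fin (j + 1) → E := fun i => ∑ k, P k i • b k
    have hb' : ∀ c : Fin (j + 1) → ℝ, ∑ i, c i • b' i = ∑ k, P.mulVec c k • b k := by
      intro c
      simp only [b', Finset.smul_sum, Matrix.mulVec, dotProduct, Finset.sum_smul]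
      rw [Finset.sum_comm]
      refine Finset.sum_congr rfl fun k _ => Finset.sum_congr rfl fun i _ => ?_
      rw [smul_smul, mul_comm]
    have hbR : ∀ y : Fin (j + 1) → ℝ, ∑ k, y k • b k = ∑ i, R.mulVec y i • b' i := by
      intro y
      rw [hb', Matrix.mulVec_mulVec, hPR, Matrix.one_mulVec]
    have hind : LinearIndependent ℝ b' := by
      rw [Fintype.linearIndependent_iff]
      intro c hc i
      rw [hb'] at hc
      have h1 : P.mulVec c = 0 := funext (Fintype.linearIndependent_iff.mp hb _ hc)
      have h2 : R.mulVec (P.mulVec c) = 0 := by rw [h1, Matrix.mulVec_zero]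
      rw [Matrix.mulVec_mulVec, hRP, Matrix.one_mulVec] at h2
      exact congrFun h2 i
    have hshort : ‖b' 0‖ ≤ 2 * ((j + 1 : ℕ) : ℝ) ^ 2 / Λ := by
      have ha : a ≠ 0 := by rintro rfl; exact hv0 (by simpa using hvB)
      have ha1 : (1 : ℝ) ≤ |(a : ℝ)| := by exact_mod_cast Int.one_le_abs ha
      have h1 : ∑ i, (v i : ℝ) • b i = (a : ℝ) • b' 0 := by
        simp only [b', Finset.smul_sum, hP, hvB, smul_smul]
        simp
      rw [h1, norm_smul, Real.norm_eq_abs] at hv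
      exact (le_mul_of_one_le_left (norm_nonneg _) ha1).trans hv
    obtain ⟨z', hz'⟩ := main b' hind (fun u hu => by
      have h1 := hdual (Matrix.vecMul u (B.toMatrix e)) (fun y => by
        have h2 := hu (R.mulVec y)
        rw [← hbR] at h2
        convert h2 using 2
        change (fun i => ((Matrix.vecMul u (B.toMatrix e)) i : ℝ)) ⬝ᵥ y
          = (fun i => (u i : ℝ)) ⬝ᵥ R.mulVec y
        rw [Matrix.dotProduct_mulVec]
        congr 1
        funext i
        simp [R, Matrix.vecMul, dotProduct])
      have h3 := congrArg (fun w => Matrix.vecMul w (e.toMatrix B)) h1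
      simpa [Matrix.vecMul_vecMul] using h3) hshort (R.mulVec x)
    refine ⟨(e.toMatrix B).mulVec z', ?_⟩
    have hPz : P.mulVec (fun i => (z' i : ℝ)) =
        fun i => (((e.toMatrix B).mulVec z' i : ℤ) : ℝ) := by
      funext i
      simp [P, Matrix.mulVec, dotProduct]
    have h5 := hb' (fun i => R.mulVec x i - z' i)
    have h6 : P.mulVec (fun i => R.mulVec x i - z' i)
        = fun i => x i - (((e.toMatrix B).mulVec z' i : ℤ) : ℝ) := by
      change P.mulVec (R.mulVec x - fun i => (z' i : ℝ)) = _
      rw [Matrix.mulVec_sub, Matrix.mulVec_mulVec, hPR, Matrix.one_mulVec, hPz]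
      rfl
    rw [h6] at h5
    rwa [← h5]

/-- The flatness theorem for the convex hull of finitely many points, with a polynomial bound. -/
theorem exists_int_mem_convexHull_of_width {r : ℕ} {ι : Type*} [Finite ι] (p : ι → Fin r → ℝ)
    (hdet : ∃ (i₀ : ι) (v : Fin r → ι), (Matrix.of fun a c => p (v c) a - p i₀ a).det ≠ 0)
    (hwidth : ∀ u : Fin r → ℤ, u ≠ 0 →
      ∃ i i', 4 * (r : ℝ) ^ 5 < ∑ a, (u a : ℝ) * (p i a - p i' a)) :
    ∃ z : Fin r → ℤ, (fun a => (z a : ℝ)) ∈ convexHull ℝ (Set.range p) := by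
  classical
  obtain ⟨i₁, v₁, hdet₁⟩ := hdet
  rcases Nat.eq_zero_or_pos r with rfl | hr
  · exact ⟨0, by
      rw [Subsingleton.elim (fun a => (((0 : Fin 0 → ℤ) a : ℤ) : ℝ)) (p i₁)]
      exact subset_convexHull ℝ _ ⟨i₁, rfl⟩⟩
  have hr' : (0 : ℝ) < r := by exact_mod_cast hr
  have : Nonempty (ι × (Fin r → ι)) := ⟨(i₁, v₁)⟩
  obtain ⟨⟨i₀, v⟩, hmax⟩ := Finite.exists_max fun q : ι × (Fin r → ι) =>
    |(Matrix.of fun a c => p (q.2 c) a - p q.1 a : Matrix (Fin r) (Fin r) ℝ).det|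
  let V : Matrix (Fin r) (Fin r) ℝ := Matrix.of fun a c => p (v c) a - p i₀ a
  have hV0 : 0 < |V.det| := (abs_pos.mpr hdet₁).trans_le (hmax (i₁, v₁))
  have hV : V.det ≠ 0 := abs_pos.mp hV0
  have hVu : IsUnit V.det := isUnit_iff_ne_zero.mpr hV
  have hcoord : ∀ i c, |V⁻¹.mulVec (p i - p i₀) c| ≤ 1 := by
    intro i c
    have h1 : V⁻¹.mulVec (p i - p i₀) c = V.det⁻¹ * (V.updateCol c (p i - p i₀)).det := by
      rw [Matrix.inv_def, Ring.inverse_eq_inv', Matrix.smul_mulVec,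
        ← Matrix.cramer_eq_adjugate_mulVec, Pi.smul_apply, Matrix.cramer_apply, smul_eq_mul]
    have h2 : V.updateCol c (p i - p i₀)
        = Matrix.of fun a c' => p (Function.update v c i c') a - p i₀ a := by
      ext a c'
      by_cases h : c' = c
      · subst h; simp
      · simp [h, V]
    have h3 := hmax (i₀, Function.update v c i)
    rw [h1, abs_mul, abs_inv, h2, inv_mul_le_one₀ hV0]
    exact h3
  let b : Fin r → EuclideanSpace ℝ (Fin r) := fun c =>
    WithLp.toLp 2 (V⁻¹.mulVec (Pi.single c 1))
  have hbsum : ∀ x : Fin r → ℝ, ∑ c, x c • b c = WithLp.toLp 2 (V⁻¹.mulVec x) := by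
    intro x
    ext a
    simp [b, Matrix.mulVec, dotProduct, mul_comm]
  have hind : LinearIndependent ℝ b := by
    rw [Fintype.linearIndependent_iff]
    intro x hx c
    rw [hbsum] at hx
    have h1 : V⁻¹.mulVec x = 0 := by simpa using hx
    have h2 : V.mulVec (V⁻¹.mulVec x) = 0 := by rw [h1, Matrix.mulVec_zero]
    rw [Matrix.mulVec_mulVec, Matrix.mul_nonsing_inv _ hVu, Matrix.one_mulVec] at h2
    exact congrFun h2 c
  have hnorm : ∀ y : Fin r → ℝ, ‖(WithLp.toLp 2 y : EuclideanSpace ℝ (Fin r))‖ ≤ ∑ c, |y c| := by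
    intro y
    rw [EuclideanSpace.norm_eq, Real.sqrt_le_left (by positivity)]
    simp only [Real.norm_eq_abs]
    exact Finset.sum_sq_le_sq_sum_of_nonneg fun i _ => abs_nonneg _
  have hΛ : (0 : ℝ) < 2 * r ^ 4 := by positivity
  obtain ⟨z, hz⟩ := exists_int_norm_sub_le b hind hΛ (fun u hu => by
    by_contra hu0
    obtain ⟨i, i', hii⟩ := hwidth u hu0
    have h1 := hu (p i - p i')
    rw [hbsum] at h1
    have h2 : ∑ c, |V⁻¹.mulVec (p i - p i') c| ≤ ∑ _c : Fin r, (2 : ℝ) := by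
      refine Finset.sum_le_sum fun c _ => ?_
      have h3 : p i - p i' = (p i - p i₀) - (p i' - p i₀) := by abel
      rw [h3, Matrix.mulVec_sub, Pi.sub_apply]
      exact (abs_sub _ _).trans (by linarith [hcoord i c, hcoord i' c])
    simp only [Finset.sum_const, Finset.card_univ, Fintype.card_fin, nsmul_eq_mul] at h2
    have h4 := (le_abs_self _).trans
      (h1.trans (mul_le_mul_of_nonneg_left ((hnorm _).trans h2) hΛ.le))
    simp only [Pi.sub_apply] at h4
    linarith [show 2 * (r : ℝ) ^ 4 * (r * 2) = 4 * r ^ 5 by ring])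
    (p i₀ + V.mulVec fun _ => 1 / (2 * r))
  let y : Fin r → ℝ := V⁻¹.mulVec ((fun a => (z a : ℝ)) - p i₀)
  have hbound : ∀ c, |1 / (2 * (r : ℝ)) - y c| ≤ 1 / (2 * r) := by
    intro c
    have h1 := hbsum fun a => (p i₀ + V.mulVec fun _ => 1 / (2 * (r : ℝ))) a - z a
    rw [h1] at hz
    have h2 : V⁻¹.mulVec (fun a => (p i₀ + V.mulVec fun _ => 1 / (2 * (r : ℝ))) a - z a)
        = (fun _ => 1 / (2 * (r : ℝ))) - y := by
      have h3 : (fun a => (p i₀ + V.mulVec fun _ => 1 / (2 * (r : ℝ))) a - z a)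
          = (V.mulVec fun _ => 1 / (2 * (r : ℝ))) - ((fun a => (z a : ℝ)) - p i₀) := by
        funext a; simp only [Pi.add_apply, Pi.sub_apply]; ring
      rw [h3, Matrix.mulVec_sub, Matrix.mulVec_mulVec, Matrix.nonsing_inv_mul _ hVu,
        Matrix.one_mulVec]
    rw [h2] at hz
    have h4 := (PiLp.norm_apply_le (WithLp.toLp 2 ((fun _ => 1 / (2 * (r : ℝ))) - y)) c).trans hz
    have h5 : (r : ℝ) ^ 3 / (2 * r ^ 4) = 1 / (2 * r) := by field_simp
    rw [h5] at h4
    exact h4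
  have hy0 : ∀ c, 0 ≤ y c := fun c => by linarith [(abs_le.mp (hbound c)).2]
  have hy1 : ∑ c, y c ≤ 1 := by
    calc ∑ c, y c ≤ ∑ _c : Fin r, 1 / (r : ℝ) := by
          refine Finset.sum_le_sum fun c _ => ?_
          have h1 := (abs_le.mp (hbound c)).1
          have h2 : 1 / (2 * (r : ℝ)) + 1 / (2 * r) = 1 / r := by field_simp; norm_num
          linarith
      _ = 1 := by simp [hr'.ne']
  have hVy : (fun a => (z a : ℝ)) = p i₀ + V.mulVec y := by
    simp only [y]
    rw [Matrix.mulVec_mulVec, Matrix.mul_nonsing_inv _ hVu, Matrix.one_mulVec]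
    abel
  refine ⟨z, ?_⟩
  have hmem := (convex_convexHull ℝ (Set.range p)).sum_mem (t := Finset.univ)
    (w := fun o : Option (Fin r) => o.elim (1 - ∑ c, y c) y)
    (z := fun o => p (o.elim i₀ v))
    (by rintro (_ | c) -
        · simpa using hy1
        · exact hy0 c)
    (by simp [Fintype.sum_option])
    (fun o _ => subset_convexHull ℝ _ ⟨_, rfl⟩)
  convert hmem using 1
  rw [hVy, Fintype.sum_option]
  funext a
  simp only [Pi.add_apply, Matrix.mulVec, dotProduct, V, Matrix.of_apply, Option.elim,
    Pi.smul_apply, smul_eq_mul, Finset.sum_apply, sub_mul, Finset.sum_sub_distrib, one_mul,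
    Finset.sum_mul]
  simp only [mul_comm]
  ring

/-- If the slice of `Q` over the range of `φ` is wide in every lattice direction, then its values
under a linear functional are controlled by those at its mixed-integer points. -/
theorem exists_mixedInt_controlling {V : Type*} [AddCommGroup V] [Module ℝ V] {r k : ℕ}
    {Q : Set V} (hQ : Convex ℝ Q) (σ : V →ᵃ[ℝ] (Fin k → ℝ))
    (φ : (Fin r → ℝ) →ᵃ[ℝ] (Fin k → ℝ)) {t W : ℝ} (ht : 0 < t) (ht1 : t < 1 / 2)
    (hW : 4 * (r : ℝ) ^ 5 ≤ t * W) (y₀ : Fin r → ℤ) (v : Fin r → Fin r → ℤ)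
    (hy₀ : ∃ q ∈ Q, σ q = φ fun a => (y₀ a : ℝ))
    (hv : ∀ c, ∃ q ∈ Q, σ q = φ fun a => (v c a : ℝ))
    (hdet : (Matrix.of fun a c => v c a - y₀ a : Matrix (Fin r) (Fin r) ℤ).det ≠ 0)
    (hwidth : ∀ u : Fin r → ℤ, u ≠ 0 → ∃ y y' : Fin r → ℝ, (∃ q ∈ Q, σ q = φ y) ∧
      (∃ q ∈ Q, σ q = φ y') ∧ W < ∑ a, (u a : ℝ) * (y a - y' a))
    (f : V →ₗ[ℝ] ℝ) {x : V} (hx : x ∈ Q) (hxφ : σ x ∈ Set.range φ) :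
    ∃ z ∈ Q, ∃ z' ∈ Q, (∃ w : Fin r → ℤ, σ z = φ fun a => (w a : ℝ)) ∧
      (∃ w : Fin r → ℤ, σ z' = φ fun a => (w a : ℝ)) ∧
      (1 - 2 * t) * f x ≤ (1 - 2 * t) * f z + t * (f z - f z') := by
  classical
  obtain ⟨yx, hyx⟩ := hxφ
  let K : Set (Fin r → ℝ) := {y | ∃ q ∈ Q, σ q = φ y}
  let D : Matrix (Fin r) (Fin r) ℤ := Matrix.of fun a c => v c a - y₀ a
  let U : Set (Fin r → ℤ) := {u | ∀ c, |((Matrix.vecMul u D c : ℤ) : ℝ)| ≤ W}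
  have hU : U.Finite := by
    have hinj : Function.Injective fun u : Fin r → ℤ => Matrix.vecMul u D := by
      intro u u' h
      have h1 : Matrix.vecMul (u - u') D = 0 := by
        rw [Matrix.sub_vecMul]; exact sub_eq_zero.mpr h
      exact sub_eq_zero.mp (Matrix.eq_zero_of_vecMul_eq_zero hdet h1)
    refine ((Set.finite_Icc (fun _ : Fin r => -⌊W⌋) (fun _ => ⌊W⌋)).preimage
      hinj.injOn).subset fun u hu => ?_
    have h2 : ∀ c, |Matrix.vecMul u D c| ≤ ⌊W⌋ := fun c => Int.le_floor.mpr (by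
      exact_mod_cast hu c)
    exact ⟨fun c => (abs_le.mp (h2 c)).1, fun c => (abs_le.mp (h2 c)).2⟩
  have hwidth' : ∀ u : Fin r → ℤ, ∃ y y' : Fin r → ℝ, u ≠ 0 →
      y ∈ K ∧ y' ∈ K ∧ W < ∑ a, (u a : ℝ) * (y a - y' a) := by
    intro u
    by_cases hu : u = 0
    · exact ⟨0, 0, fun h => absurd hu h⟩
    · obtain ⟨y, y', h⟩ := hwidth u hu
      exact ⟨y, y', fun _ => h⟩
  choose wit witR hwit using hwidth'
  let F : Set (Fin r → ℝ) := insert (fun a => (y₀ a : ℝ))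
    ((Set.range fun c a => (v c a : ℝ)) ∪ (wit '' (U \ {0}) ∪ witR '' (U \ {0})))
  have hF : F.Finite := ((Set.finite_range _).union
    ((hU.sdiff.image _).union (hU.sdiff.image _))).insert _
  have hFK : F ⊆ K := by
    rintro y (rfl | ⟨c, rfl⟩ | ⟨u, ⟨-, hu⟩, rfl⟩ | ⟨u, ⟨-, hu⟩, rfl⟩)
    · exact hy₀
    · exact hv c
    · exact (hwit u hu).1
    · exact (hwit u hu).2.1
  have : Finite F := hF
  choose q₀ hq₀Q hq₀ using fun i : F => hFK i.2
  let p : Option F → Fin r → ℝ := fun i => i.elim yx fun i => i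
  let q : Option F → V := fun i => i.elim x q₀
  have hqQ : ∀ i, q i ∈ Q := by rintro (_ | i); exacts [hx, hq₀Q i]
  have hqp : ∀ i, σ (q i) = φ (p i) := by rintro (_ | i); exacts [hyx.symm, hq₀ i]
  have hpF : ∀ y ∈ F, ∃ i, p i = y := fun y hy => ⟨some ⟨y, hy⟩, rfl⟩
  obtain ⟨i₀, hi₀⟩ := hpF _ (Set.mem_insert _ _)
  choose iv hiv using fun c => hpF _ (Set.mem_insert_of_mem _ (Or.inl ⟨c, rfl⟩))
  have hpwidth : ∀ u : Fin r → ℤ, u ≠ 0 →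
      ∃ i i', W < ∑ a, (u a : ℝ) * (p i a - p i' a) := by
    intro u hu
    by_cases huU : u ∈ U
    · obtain ⟨i, hi⟩ := hpF (wit u) (Or.inr (Or.inr (Or.inl ⟨u, ⟨huU, hu⟩, rfl⟩)))
      obtain ⟨i', hi'⟩ := hpF (witR u) (Or.inr (Or.inr (Or.inr ⟨u, ⟨huU, hu⟩, rfl⟩)))
      exact ⟨i, i', by rw [hi, hi']; exact (hwit u hu).2.2⟩
    · obtain ⟨c, hc⟩ := not_forall.mp huU
      have h1 : ((Matrix.vecMul u D c : ℤ) : ℝ) = ∑ a, (u a : ℝ) * (p (iv c) a - p i₀ a) := by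
        simp [hiv, hi₀, D, Matrix.vecMul, dotProduct]
      rw [h1, not_le, lt_abs] at hc
      rcases hc with hc | hc
      · exact ⟨_, _, hc⟩
      · refine ⟨i₀, iv c, hc.trans_eq ?_⟩
        rw [← Finset.sum_neg_distrib]
        exact Finset.sum_congr rfl fun a _ => by ring
  have shrink : ∀ (g : V →ₗ[ℝ] ℝ) (a : Option F) (m : ℝ), (∀ i, m ≤ g (q i)) →
      ∃ z ∈ Q, (∃ w : Fin r → ℤ, σ z = φ fun a => (w a : ℝ)) ∧
        (1 - t) * g (q a) + t * m ≤ g z := by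
    intro g a m hm
    obtain ⟨w, hw⟩ := exists_int_mem_convexHull_of_width
      (fun i => (1 - t) • p a + t • p i)
      ⟨i₀, iv, by
        have h1 : (Matrix.of fun a' c => ((1 - t) • p a + t • p (iv c)) a'
            - ((1 - t) • p a + t • p i₀) a')
            = t • (Int.castRingHom ℝ).mapMatrix D := by
          ext a' c
          simp [hiv, hi₀, D]
          ring
        rw [h1, Matrix.det_smul, ← RingHom.map_det]
        exact mul_ne_zero (pow_ne_zero _ ht.ne') (by simpa using hdet)⟩
      (fun u hu => by
        obtain ⟨i, i', h⟩ := hpwidth u hu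
        refine ⟨i, i', hW.trans_lt ?_⟩
        have h1 : ∑ a', (u a' : ℝ) * (((1 - t) • p a + t • p i) a'
            - ((1 - t) • p a + t • p i') a') = t * ∑ a', (u a' : ℝ) * (p i a' - p i' a') := by
          rw [Finset.mul_sum]
          refine Finset.sum_congr rfl fun a' _ => ?_
          simp only [Pi.add_apply, Pi.smul_apply, smul_eq_mul]
          ring
        rw [h1]
        exact mul_lt_mul_of_pos_left h ht)
    let T : Set (Fin r → ℝ) :=
      {y | ∃ z ∈ Q, σ z = φ y ∧ (1 - t) * g (q a) + t * m ≤ g z}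
    have hT : Convex ℝ T := by
      rintro y ⟨z, hz, hzy, hzg⟩ y' ⟨z', hz', hzy', hzg'⟩ c c' hc hc' hcc
      refine ⟨c • z + c' • z', hQ hz hz' hc hc' hcc, ?_, ?_⟩
      · rw [Convex.combo_affine_apply hcc, Convex.combo_affine_apply hcc, hzy, hzy']
      · rw [map_add, map_smul, map_smul, smul_eq_mul, smul_eq_mul]
        calc (1 - t) * g (q a) + t * m = c * ((1 - t) * g (q a) + t * m)
              + c' * ((1 - t) * g (q a) + t * m) := by rw [← add_mul, hcc, one_mul]
          _ ≤ _ := by gcongr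
    obtain ⟨z, hz, hzσ, hzg⟩ := convexHull_min (s := Set.range fun i => (1 - t) • p a + t • p i)
      (t := T) (by
        rintro _ ⟨i, rfl⟩
        refine ⟨(1 - t) • q a + t • q i,
          hQ (hqQ a) (hqQ i) (by linarith) ht.le (by ring), ?_, ?_⟩
        · rw [Convex.combo_affine_apply (by ring), Convex.combo_affine_apply (by ring),
            hqp, hqp]
        · rw [map_add, map_smul, map_smul, smul_eq_mul, smul_eq_mul]
          gcongr
          exact hm i) hT hw
    exact ⟨z, hz, ⟨w, hzσ⟩, hzg⟩
  obtain ⟨i, hi⟩ := Finite.exists_max fun i => f (q i)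
  obtain ⟨i', hi'⟩ := Finite.exists_min fun i => f (q i)
  obtain ⟨z, hz, hzw, hzf⟩ := shrink f i _ hi'
  obtain ⟨z', hz', hzw', hzf'⟩ := shrink (-f) i' (-f (q i)) fun c => neg_le_neg (hi c)
  refine ⟨z, hz, z', hz', hzw, hzw', ?_⟩
  have h1 : f x ≤ f (q i) := hi none
  simp only [LinearMap.neg_apply] at hzf'
  nlinarith

/-- The lattice points in a real hyperplane are parametrized by a lattice of smaller rank. -/
theorem exists_affine_parametrization {r : ℕ} {a : Fin r → ℝ} (ha : a ≠ 0) (β : ℝ) :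
    ∃ n < r, ∃ ψ : (Fin n → ℝ) →ᵃ[ℝ] (Fin r → ℝ),
      (∀ w : Fin n → ℤ, ∃ z : Fin r → ℤ, ψ (fun i => (w i : ℝ)) = fun i => (z i : ℝ)) ∧
      ∀ z : Fin r → ℤ, ∑ i, a i * z i = β →
        ∃ w : Fin n → ℤ, (fun i => (z i : ℝ)) = ψ fun i => (w i : ℝ) := by
  classical
  by_cases hne : ∃ z : Fin r → ℤ, ∑ i, a i * z i = β
  swap
  · refine ⟨0, ?_, AffineMap.const ℝ _ 0, fun w => ⟨0, by ext; simp⟩,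
      fun z hz => absurd ⟨z, hz⟩ hne⟩
    rcases Nat.eq_zero_or_pos r with rfl | h
    · exact absurd (Subsingleton.elim a 0) ha
    · exact h
  obtain ⟨z₀, hz₀⟩ := hne
  let l : (Fin r → ℤ) →ₗ[ℤ] ℝ := Fintype.linearCombination ℤ a
  have hl : ∀ z, l z = ∑ i, a i * z i := by
    intro z; simp [l, Fintype.linearCombination_apply, mul_comm]
  obtain ⟨n, bM, bN, f, d, snf⟩ :=
    Submodule.smithNormalForm (Pi.basisFun ℤ (Fin r)) (LinearMap.ker l)
  have hnr : n ≤ r := by simpa using Fintype.card_le_of_embedding f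
  have hn : n < r := by
    refine lt_of_le_of_ne hnr ?_
    rintro rfl
    have hsurj : Function.Surjective f := Finite.surjective_of_injective f.injective
    have hl0 : l = 0 := by
      refine bM.ext fun i => ?_
      obtain ⟨c, rfl⟩ := hsurj i
      have h1 : l (bN c) = 0 := (bN c).2
      rw [snf, map_smul] at h1
      rcases smul_eq_zero.mp h1 with h2 | h2
      · exact absurd (Subtype.ext (by rw [snf, h2]; simp)) (bN.ne_zero c)
      · simpa using h2
    apply ha
    funext i
    have h3 := hl (Pi.single i 1)
    rw [hl0] at h3
    simpa [Pi.single_apply] using h3.symm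
  refine ⟨n, hn,
    (Fintype.linearCombination ℝ fun c i => (((bN c : Fin r → ℤ) i : ℤ) : ℝ)).toAffineMap
    + AffineMap.const ℝ _ fun i => (z₀ i : ℝ), fun w => ⟨∑ c, w c • (bN c : Fin r → ℤ) + z₀, ?_⟩,
    fun z hz => ?_⟩
  · funext i
    simp [Fintype.linearCombination_apply]
  · have hmem : z - z₀ ∈ LinearMap.ker l := by
      rw [LinearMap.mem_ker, map_sub, hl, hl, hz, hz₀, sub_self]
    refine ⟨fun c => bN.repr ⟨z - z₀, hmem⟩ c, ?_⟩
    have h1 := congrArg Subtype.val (bN.sum_repr ⟨z - z₀, hmem⟩)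
    funext i
    have h2 := congrFun h1 i
    simp only [Submodule.coe_sum, Submodule.coe_smul, Finset.sum_apply, Pi.smul_apply,
      Pi.sub_apply, smul_eq_mul] at h2
    have h3 := congrArg (Int.cast : ℤ → ℝ) h2
    push_cast at h3
    simp only [AffineMap.coe_add, Pi.add_apply, LinearMap.coe_toAffineMap,
      Fintype.linearCombination_apply, AffineMap.const_apply, Finset.sum_apply, Pi.smul_apply,
      smul_eq_mul]
    rw [h3]
    ring

/-- A set of lattice points lying in no real hyperplane contains an affine frame. -/
theorem exists_det_ne_zero_of_not_subset_hyperplane {r : ℕ} {S : Set (Fin r → ℤ)}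
    (h : ∀ a : Fin r → ℝ, a ≠ 0 → ∀ β : ℝ, ∃ z ∈ S, ∑ i, a i * z i ≠ β)
    {y₀ : Fin r → ℤ} :
    ∃ v : Fin r → Fin r → ℤ, (∀ c, v c ∈ S) ∧
      (Matrix.of fun a c => v c a - y₀ a : Matrix (Fin r) (Fin r) ℤ).det ≠ 0 := by
  classical
  let s : Set (Fin r → ℝ) := (fun z i => ((z i - y₀ i : ℤ) : ℝ)) '' S
  have hs : ⊤ ≤ Submodule.span ℝ s := by
    by_contra hlt
    obtain ⟨g, hg0, hg⟩ := Submodule.exists_le_ker_of_lt_top _ (lt_top_iff_ne_top.mpr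
      fun h => hlt h.ge)
    have hga : ∀ y : Fin r → ℝ, g y = ∑ i, g (Pi.single i 1) * y i := by
      intro y
      conv_lhs => rw [← Finset.univ_sum_single y]
      rw [map_sum]
      refine Finset.sum_congr rfl fun i _ => ?_
      rw [mul_comm, ← smul_eq_mul, ← map_smul, ← Pi.single_smul, smul_eq_mul, mul_one]
    obtain ⟨z, hz, hzne⟩ := h (fun i => g (Pi.single i 1))
      (fun h0 => hg0 (LinearMap.ext fun y => by
        rw [hga]
        simp [fun i => congrFun h0 i]))
      (∑ i, g (Pi.single i 1) * y₀ i)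
    apply hzne
    have h1 : g (fun i => ((z i - y₀ i : ℤ) : ℝ)) = 0 := hg (Submodule.subset_span ⟨z, hz, rfl⟩)
    rw [hga] at h1
    rw [← sub_eq_zero, ← Finset.sum_sub_distrib, ← h1]
    refine Finset.sum_congr rfl fun i _ => ?_
    push_cast
    ring
  let e := Pi.basisFun ℝ (Fin r)
  let B := Module.Basis.ofSpan hs
  let B' := B.reindex (B.indexEquiv e)
  have hB : ∀ c, B' c ∈ s := fun c => by
    apply Module.Basis.ofSpan_subset hs
    rw [Module.Basis.reindex_apply]
    exact ⟨_, rfl⟩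
  choose v hv hvB using hB
  refine ⟨v, hv, fun h0 => ?_⟩
  have h1 := e.isUnit_det B'
  rw [Module.Basis.det_apply] at h1
  have h2 : e.toMatrix B' = (Int.castRingHom ℝ).mapMatrix
      (Matrix.of fun a c => v c a - y₀ a : Matrix (Fin r) (Fin r) ℤ) := by
    ext a c
    simp [e, Module.Basis.toMatrix_apply, ← hvB]
  rw [h2, ← RingHom.map_det, h0, map_zero] at h1
  exact not_isUnit_zero h1

/-- The mixed-integer points of a convex set are covered by few slices, on each of which linear
functionals are controlled by their values at mixed-integer points. -/
theorem exists_slices_cover {V : Type*} [AddCommGroup V] [Module ℝ V] {k : ℕ}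
    {Q : Set V} (hQ : Convex ℝ Q) (σ : V →ᵃ[ℝ] (Fin k → ℝ)) {t : ℝ} {W : ℕ} (ht : 0 < t)
    (ht1 : t < 1 / 2) (hW : 4 * (k : ℝ) ^ 5 ≤ t * W) (r : ℕ) (hr : r ≤ k)
    (φ : (Fin r → ℝ) →ᵃ[ℝ] (Fin k → ℝ))
    (hφ : ∀ w : Fin r → ℤ, IsLatticePoint (φ fun i => (w i : ℝ))) :
    ∃ 𝓗 : Finset (AffineSubspace ℝ (Fin k → ℝ)), 𝓗.card ≤ (W + 1) ^ r ∧
      (∀ x ∈ Q, (∃ w : Fin r → ℤ, σ x = φ fun i => (w i : ℝ)) → ∃ H ∈ 𝓗, σ x ∈ H) ∧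
      ∀ H ∈ 𝓗, (∃ x ∈ Q, σ x ∈ H) ∧ ∀ (f : V →ₗ[ℝ] ℝ), ∀ x ∈ Q, σ x ∈ H →
        ∃ z ∈ Q, ∃ z' ∈ Q, IsLatticePoint (σ z) ∧ IsLatticePoint (σ z') ∧
          (1 - 2 * t) * f x ≤ (1 - 2 * t) * f z + t * (f z - f z') := by
  classical
  induction r using Nat.strong_induction_on with
  | _ r ih =>
  let S : Set (Fin r → ℤ) := {w | ∃ q ∈ Q, σ q = φ fun i => (w i : ℝ)}
  have slice : ∀ (a : Fin r → ℝ), a ≠ 0 → ∀ β : ℝ,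
      ∃ 𝓗 : Finset (AffineSubspace ℝ (Fin k → ℝ)), 𝓗.card ≤ (W + 1) ^ (r - 1) ∧
      (∀ x ∈ Q, (∃ w : Fin r → ℤ, σ x = φ (fun i => (w i : ℝ)) ∧ ∑ i, a i * w i = β) →
        ∃ H ∈ 𝓗, σ x ∈ H) ∧
      ∀ H ∈ 𝓗, (∃ x ∈ Q, σ x ∈ H) ∧ ∀ (f : V →ₗ[ℝ] ℝ), ∀ x ∈ Q, σ x ∈ H →
        ∃ z ∈ Q, ∃ z' ∈ Q, IsLatticePoint (σ z) ∧ IsLatticePoint (σ z') ∧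
          (1 - 2 * t) * f x ≤ (1 - 2 * t) * f z + t * (f z - f z') := by
    intro a ha β
    obtain ⟨n, hn, ψ, hψ, hψS⟩ := exists_affine_parametrization ha β
    obtain ⟨𝓗, hcard, hcov, hgood⟩ := ih n hn (hn.le.trans hr) (φ.comp ψ) (fun w => by
      obtain ⟨z, hz⟩ := hψ w
      rw [AffineMap.comp_apply, hz]
      exact hφ z)
    refine ⟨𝓗, hcard.trans (Nat.pow_le_pow_right W.succ_pos (by omega)), ?_, hgood⟩
    rintro x hx ⟨w, hw, hwβ⟩
    obtain ⟨w', hw'⟩ := hψS w hwβ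
    exact hcov x hx ⟨w', by rw [hw, hw', AffineMap.comp_apply]⟩
  rcases S.eq_empty_or_nonempty with hS | ⟨y₀, hy₀⟩
  · refine ⟨∅, by simp, ?_, by simp⟩
    rintro x hx ⟨w, hw⟩
    have hwS : w ∈ S := ⟨x, hx, hw⟩
    simp [hS] at hwS
  by_cases hplane : ∃ a : Fin r → ℝ, a ≠ 0 ∧ ∃ β : ℝ, ∀ z ∈ S, ∑ i, a i * z i = β
  · obtain ⟨a, ha, β, hβ⟩ := hplane
    obtain ⟨𝓗, hcard, hcov, hgood⟩ := slice a ha β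
    refine ⟨𝓗, hcard.trans (Nat.pow_le_pow_right W.succ_pos (by omega)), ?_, hgood⟩
    rintro x hx ⟨w, hw⟩
    exact hcov x hx ⟨w, hw, hβ w ⟨x, hx, hw⟩⟩
  by_cases hthin : ∃ u : Fin r → ℤ, u ≠ 0 ∧ ∀ y y' : Fin r → ℝ, (∃ q ∈ Q, σ q = φ y) →
      (∃ q ∈ Q, σ q = φ y') → ∑ a, (u a : ℝ) * (y a - y' a) ≤ W
  · obtain ⟨u, hu, huW⟩ := hthin
    have hr0 : 0 < r := by
      rcases Nat.eq_zero_or_pos r with rfl | h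
      · exact absurd (Subsingleton.elim u 0) hu
      · exact h
    have hdiff : ∀ z ∈ S, ∀ z' ∈ S, ∑ i, u i * z i ≤ ∑ i, u i * z' i + W := by
      intro z hz z' hz'
      have h1 := huW _ _ hz hz'
      simp only [mul_sub, Finset.sum_sub_distrib] at h1
      have h2 : ((∑ i, u i * z i : ℤ) : ℝ) ≤ ((∑ i, u i * z' i + W : ℤ) : ℝ) := by
        push_cast
        linarith
      exact_mod_cast h2
    obtain ⟨c₀, ⟨z₀, hz₀, hc₀⟩, hmin⟩ := Int.exists_least_of_bdd
      (P := fun c => ∃ z ∈ S, ∑ i, u i * z i = c)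
      ⟨∑ i, u i * y₀ i - W, by
        rintro _ ⟨z, hz, rfl⟩
        linarith [hdiff y₀ hy₀ z hz]⟩
      ⟨_, y₀, hy₀, rfl⟩
    have hu' : (fun i => (u i : ℝ)) ≠ 0 := fun h => hu (funext fun i => by
      simpa using congrFun h i)
    choose 𝓗 hcard hcov hgood using fun c : ℤ => slice _ hu' (c : ℝ)
    refine ⟨(Finset.Icc c₀ (c₀ + W)).biUnion 𝓗, ?_, ?_, ?_⟩
    · calc _ ≤ (Finset.Icc c₀ (c₀ + W)).card * (W + 1) ^ (r - 1) :=
            Finset.card_biUnion_le_card_mul _ _ _ fun c _ => hcard c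
        _ = (W + 1) ^ r := by
            rw [Int.card_Icc, show (c₀ + W + 1 - c₀).toNat = W + 1 by omega, ← pow_succ',
              Nat.sub_add_cancel hr0]
    · rintro x hx ⟨w, hw⟩
      have hwS : w ∈ S := ⟨x, hx, hw⟩
      obtain ⟨H, hH, hxH⟩ := hcov (∑ i, u i * w i) x hx ⟨w, hw, by push_cast; rfl⟩
      refine ⟨H, Finset.mem_biUnion.mpr ⟨_, Finset.mem_Icc.mpr ⟨hmin _ ⟨w, hwS, rfl⟩, ?_⟩, hH⟩, hxH⟩
      rw [← hc₀]
      exact hdiff w hwS z₀ hz₀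
    · intro H hH
      obtain ⟨c, -, hc⟩ := Finset.mem_biUnion.mp hH
      exact hgood c H hc
  · push Not at hplane hthin
    obtain ⟨v, hv, hdet⟩ := exists_det_ne_zero_of_not_subset_hyperplane hplane (y₀ := y₀)
    have hmem : ∀ y, y ∈ (⊤ : AffineSubspace ℝ (Fin r → ℝ)).map φ ↔ y ∈ Set.range φ := by
      intro y; simp [AffineSubspace.mem_map]
    refine ⟨{(⊤ : AffineSubspace ℝ (Fin r → ℝ)).map φ}, ?_, ?_, ?_⟩
    · simpa using Nat.one_le_pow _ _ W.succ_pos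
    · rintro x - ⟨w, hw⟩
      exact ⟨_, Finset.mem_singleton_self _, (hmem _).mpr ⟨_, hw.symm⟩⟩
    · intro H hH
      rw [Finset.mem_singleton.mp hH]
      refine ⟨?_, fun f x hx hxH => ?_⟩
      · obtain ⟨q, hq, hqσ⟩ := hy₀
        exact ⟨q, hq, (hmem _).mpr ⟨_, hqσ.symm⟩⟩
      · obtain ⟨z, hz, z', hz', ⟨w, hw⟩, ⟨w', hw'⟩, h⟩ :=
          exists_mixedInt_controlling hQ σ φ ht ht1 (W := W)
            (le_trans (by gcongr) hW) y₀ v hy₀ hv hdet hthin f hx ((hmem _).mp hxH)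
        exact ⟨z, hz, z', hz', hw ▸ hφ w, hw' ▸ hφ w', h⟩

/-- Points of `B` project close to `C` when `relDist C B` is small. -/
theorem exists_abs_sub_le_of_relDist_le {ι : Type*} {C B : Set (ι → ℝ)} {ε : ℝ} (hε : 0 ≤ ε)
    (h : relDist C B ≤ ENNReal.ofReal ε) (g : (ι → ℝ) →ₗ[ℝ] ℝ) {w : ℝ} (hw : 0 ≤ w)
    (hC : ∀ a ∈ C, ∀ a' ∈ C, g a - g a' ≤ w) {y : ι → ℝ} (hy : y ∈ B) {η : ℝ} (hη : 0 < η) :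
    ∃ a ∈ C, |g y - g a| ≤ ε * w + η := by
  have h1 := (le_iSup _ g).trans h
  have hD : (⨆ a ∈ C, ⨆ a' ∈ C, ENNReal.ofReal |g a - g a'|) ≤ ENNReal.ofReal w :=
    iSup₂_le fun a ha => iSup₂_le fun a' ha' => ENNReal.ofReal_le_ofReal
      (abs_le.mpr ⟨by linarith [hC a' ha' a ha], hC a ha a' ha'⟩)
  rw [ENNReal.div_le_iff_le_mul (Or.inr ENNReal.ofReal_ne_top)
    (Or.inl (hD.trans_lt ENNReal.ofReal_lt_top).ne)] at h1
  have h2 := (le_iSup₂ (f := fun b _ => ⨅ a ∈ C, ENNReal.ofReal |g b - g a|) y hy).trans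
    (h1.trans (mul_le_mul_right hD _))
  rw [← ENNReal.ofReal_mul hε] at h2
  have h3 := h2.trans_lt ((ENNReal.ofReal_lt_ofReal_iff
    (by positivity : 0 < ε * w + η)).mpr (by linarith))
  simp only [iInf_lt_iff] at h3
  obtain ⟨a, ha, h4⟩ := h3
  exact ⟨a, ha, ((ENNReal.ofReal_lt_ofReal_iff (by positivity)).mp h4).le⟩

/-- A criterion for bounding the relative distance in terms of linear functionals. -/
theorem relDist_le_of_forall_le {ι : Type*} {C B : Set (ι → ℝ)} (hC : Convex ℝ C)
    (hne : C.Nonempty) {ε : ℝ} (hε : 0 ≤ ε)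
    (h : ∀ (g : (ι → ℝ) →ₗ[ℝ] ℝ) (w s : ℝ), 0 ≤ w → (∀ a ∈ C, ∀ a' ∈ C, g a - g a' ≤ w) →
      (∀ a ∈ C, g a ≤ s) → ∀ b ∈ B, g b ≤ s + ε * w) :
    relDist C B ≤ ENNReal.ofReal ε := by
  refine iSup_le fun g => ?_
  set D := ⨆ a ∈ C, ⨆ a' ∈ C, ENNReal.ofReal |g a - g a'| with hDdef
  by_cases hD : D = ∞
  · rw [hD, ENNReal.div_top]; exact zero_le
  have hw : ∀ a ∈ C, ∀ a' ∈ C, g a - g a' ≤ D.toReal := by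
    intro a ha a' ha'
    have h1 : ENNReal.ofReal |g a - g a'| ≤ D :=
      (le_iSup₂ (f := fun a' _ => ENNReal.ofReal |g a - g a'|) a' ha').trans
        (le_iSup₂ (f := fun a _ => ⨆ a' ∈ C, ENNReal.ofReal |g a - g a'|) a ha)
    exact (le_abs_self _).trans ((ENNReal.ofReal_le_iff_le_toReal hD).mp h1)
  have hw0 : 0 ≤ D.toReal := ENNReal.toReal_nonneg
  apply ENNReal.div_le_of_le_mul
  refine iSup₂_le fun b hb => ?_
  -- If all of `g '' C` lies below `g b`, there are points of `C` almost attaining the bound.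
  have above : ∀ g : (ι → ℝ) →ₗ[ℝ] ℝ, (∀ a ∈ C, ∀ a' ∈ C, g a - g a' ≤ D.toReal) →
      (∀ a ∈ C, g a < g b) → ∀ η : ℝ, 0 < η → ∃ a ∈ C, |g b - g a| ≤ ε * D.toReal + η := by
    intro g hw hlt η hη
    obtain ⟨a₀, ha₀⟩ := hne
    have hbdd : BddAbove (g '' C) := ⟨g b, by rintro _ ⟨a, ha, rfl⟩; exact (hlt a ha).le⟩
    obtain ⟨_, ⟨a, ha, rfl⟩, hlt'⟩ :=
      exists_lt_of_lt_csSup (s := g '' C) ⟨_, a₀, ha₀, rfl⟩ (sub_lt_self (sSup (g '' C)) hη)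
    refine ⟨a, ha, ?_⟩
    have h1 := h g _ _ hw0 hw (fun a ha => le_csSup hbdd ⟨a, ha, rfl⟩) b hb
    rw [abs_of_pos (sub_pos.mpr (hlt a ha))]
    linarith
  have key : ∀ η : ℝ, 0 < η → ∃ a ∈ C, |g b - g a| ≤ ε * D.toReal + η := by
    intro η hη
    by_cases h1 : ∀ a ∈ C, g a < g b
    · exact above g hw h1 η hη
    by_cases h2 : ∀ a ∈ C, g b < g a
    · obtain ⟨a, ha, h3⟩ := above (-g)
        (fun a ha a' ha' => by
          simp only [LinearMap.neg_apply]
          linarith [hw a' ha' a ha])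
        (fun a ha => by simpa using h2 a ha) η hη
      refine ⟨a, ha, ?_⟩
      rw [← abs_neg]
      simp only [LinearMap.neg_apply] at h3
      convert h3 using 2
      ring
    push Not at h1 h2
    obtain ⟨a₁, ha₁, h1⟩ := h1
    obtain ⟨a₂, ha₂, h2⟩ := h2
    obtain ⟨a, ha, hab⟩ := (hC.linear_image g).ordConnected.out ⟨a₂, ha₂, rfl⟩ ⟨a₁, ha₁, rfl⟩
      ⟨h2, h1⟩
    refine ⟨a, ha, ?_⟩
    rw [hab]
    simp only [sub_self, abs_zero]
    positivity
  refine ENNReal.le_of_forall_pos_le_add fun η hη _ => ?_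
  obtain ⟨a, ha, h1⟩ := key η hη
  refine (iInf₂_le a ha).trans ((ENNReal.ofReal_le_ofReal h1).trans ?_)
  rw [ENNReal.ofReal_add (by positivity) η.coe_nonneg, ENNReal.ofReal_mul hε,
    ENNReal.ofReal_toReal hD, ENNReal.ofReal_coe_nnreal]

theorem IsPolyhedronOfSize.convex {ι : Type*} {Q : Set (ι → ℝ)} {m : ℕ}
    (h : IsPolyhedronOfSize Q m) : Convex ℝ Q := by
  obtain ⟨S, nh, -, f, b, rfl⟩ := h
  refine S.convex.inter ?_
  rw [Set.ofPred_forall]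
  exact convex_iInter fun i => convex_halfSpace_le (f i).isLinear (b i)

/-- Polyhedra in an abstract finite-dimensional space can be moved to a coordinate space. -/
theorem exists_linearEquiv_isPolyhedronOfSize {E : Type*} [AddCommGroup E] [Module ℝ E]
    [FiniteDimensional ℝ E] {J : Type*} [Fintype J] (S : AffineSubspace ℝ E) (f : J → E →ₗ[ℝ] ℝ)
    (b : J → ℝ) :
    ∃ (l : ℕ) (e : E ≃ₗ[ℝ] (Fin l → ℝ)),
      IsPolyhedronOfSize (e '' ((S : Set E) ∩ {x | ∀ i, f i x ≤ b i})) (Fintype.card J) := by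
  let e := (Module.finBasis ℝ E).equivFun
  let j := (Fintype.equivFin J).symm
  refine ⟨_, e, S.map e.toLinearMap.toAffineMap, _, le_rfl, fun i => f (j i) ∘ₗ e.symm.toLinearMap,
    fun i => b (j i), ?_⟩
  ext y
  obtain ⟨x, rfl⟩ := e.surjective y
  simp [j.surjective.forall]

/-- Balas' extended formulation for the convex hull of a union of polyhedra. -/
theorem exists_union_extended_formulation {ι : Type*} {l N nh : ℕ}
    (A : Fin N → AffineSubspace ℝ (Fin l → ℝ)) (f : Fin nh → (Fin l → ℝ) →ₗ[ℝ] ℝ)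
    (b : Fin nh → ℝ) (hne : ∀ i, ∃ x ∈ A i, ∀ a, f a x ≤ b a)
    (π : (Fin l → ℝ) →ᵃ[ℝ] (ι → ℝ)) :
    ∃ (l' : ℕ) (R : Set (Fin l' → ℝ)) (ρ : (Fin l' → ℝ) →ᵃ[ℝ] (ι → ℝ)),
      IsPolyhedronOfSize R (N * (nh + 1)) ∧
      (∀ i, ∀ x ∈ A i, (∀ a, f a x ≤ b a) → π x ∈ ρ '' R) ∧
      ∀ (g : (ι → ℝ) →ₗ[ℝ] ℝ) (s : ℝ),
        (∀ i, ∀ x ∈ A i, (∀ a, f a x ≤ b a) → g (π x) ≤ s) → ∀ y ∈ ρ '' R, g y ≤ s := by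
  classical
  choose p hpA hpf using hne
  let fstL (i : Fin N) : (Fin N → (Fin l → ℝ) × ℝ) →ₗ[ℝ] (Fin l → ℝ) :=
    LinearMap.fst ℝ _ _ ∘ₗ LinearMap.proj i
  let sndL (i : Fin N) : (Fin N → (Fin l → ℝ) × ℝ) →ₗ[ℝ] ℝ :=
    LinearMap.snd ℝ _ _ ∘ₗ LinearMap.proj i
  let S : AffineSubspace ℝ (Fin N → (Fin l → ℝ) × ℝ) :=
    { carrier := {y | (∀ i, (y i).1 - (y i).2 • p i ∈ (A i).direction) ∧ ∑ i, (y i).2 = 1}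
      smul_vsub_vadd_mem' := by
        rintro c y₁ y₂ y₃ ⟨h₁, h₁'⟩ ⟨h₂, h₂'⟩ ⟨h₃, h₃'⟩
        refine ⟨fun i => ?_, ?_⟩
        · have h := (A i).direction.add_mem ((A i).direction.smul_mem c
            ((A i).direction.sub_mem (h₁ i) (h₂ i))) (h₃ i)
          convert h using 1
          simp only [vsub_eq_sub, vadd_eq_add, Pi.add_apply, Pi.smul_apply, Pi.sub_apply,
            Prod.fst_add, Prod.smul_fst, Prod.fst_sub, Prod.snd_add, Prod.smul_snd, Prod.snd_sub,
            smul_eq_mul]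
          module
        · simp only [vsub_eq_sub, vadd_eq_add, Pi.add_apply, Pi.smul_apply, Pi.sub_apply,
            Prod.snd_add, Prod.smul_snd, Prod.snd_sub, smul_eq_mul, Finset.sum_add_distrib,
            ← Finset.mul_sum, Finset.sum_sub_distrib, h₁', h₂', h₃']
          ring }
  let F : Fin N × Option (Fin nh) → (Fin N → (Fin l → ℝ) × ℝ) →ₗ[ℝ] ℝ := fun q =>
    q.2.elim (-sndL q.1) fun a => f a ∘ₗ fstL q.1 - b a • sndL q.1
  obtain ⟨l', e, he⟩ := exists_linearEquiv_isPolyhedronOfSize S F 0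
  rw [Fintype.card_prod, Fintype.card_option, Fintype.card_fin, Fintype.card_fin] at he
  let T : (Fin N → (Fin l → ℝ) × ℝ) →ₗ[ℝ] (ι → ℝ) :=
    ∑ i, (π.linear ∘ₗ fstL i + (sndL i).smulRight (π 0))
  have hT : ∀ y, T y = ∑ i, (π.linear (y i).1 + (y i).2 • π 0) := by
    intro y
    simp [T, fstL, sndL]
  have hπ : ∀ x, π x = π.linear x + π 0 := fun x => congrFun π.decomp x
  refine ⟨l', _, (T ∘ₗ e.symm.toLinearMap).toAffineMap, he, ?_, ?_⟩
  · intro i x hx hxf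
    refine ⟨_, ⟨Pi.single i (x, 1), ⟨⟨fun i' => ?_, ?_⟩, ?_⟩, rfl⟩, ?_⟩
    · by_cases h : i' = i
      · subst h
        simpa using AffineSubspace.vsub_mem_direction hx (hpA i')
      · simp [h]
    · rw [Finset.sum_eq_single i (fun i' _ h => by simp [h]) (by simp)]
      simp
    · rintro ⟨i', _ | a⟩
      · by_cases h : i' = i
        · subst h; simp [F, sndL]
        · simp [F, sndL, h]
      · by_cases h : i' = i
        · subst h; simpa [F, sndL, fstL] using hxf a
        · simp [F, sndL, fstL, h]
    · simp only [LinearMap.coe_toAffineMap, LinearMap.comp_apply, LinearEquiv.coe_coe,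
        LinearEquiv.symm_apply_apply]
      rw [hT, Finset.sum_eq_single i (fun i' _ h => by simp [h]) (by simp), hπ x]
      simp
  · rintro g s hs _ ⟨_, ⟨y, ⟨⟨hyA, hy1⟩, hyF⟩, rfl⟩, rfl⟩
    simp only [LinearMap.coe_toAffineMap, LinearMap.comp_apply, LinearEquiv.coe_coe,
      LinearEquiv.symm_apply_apply]
    rw [hT, map_sum]
    have hterm : ∀ i, g (π.linear (y i).1 + (y i).2 • π 0) ≤ (y i).2 * s := by
      intro i
      have h0 : 0 ≤ (y i).2 := by simpa [F, sndL] using hyF (i, none)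
      have hf : ∀ a, f a (y i).1 ≤ b a * (y i).2 := fun a => by
        simpa [F, sndL, fstL] using hyF (i, some a)
      rcases h0.eq_or_lt with h0 | h0
      · have hA : (y i).1 ∈ (A i).direction := by simpa [← h0] using hyA i
        have hray : ∀ c : ℝ, 0 ≤ c → g (π (p i)) + c * g (π.linear (y i).1) ≤ s := by
          intro c hc
          have h1 := hs i (c • (y i).1 + p i)
            (AffineSubspace.vadd_mem_of_mem_direction ((A i).direction.smul_mem c hA) (hpA i))
            (fun a => by
              have h2 := hf a
              rw [← h0, mul_zero] at h2
              rw [map_add, map_smul, smul_eq_mul]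
              linarith [hpf i a, mul_nonpos_of_nonneg_of_nonpos hc h2])
          rw [hπ, map_add π.linear, map_smul, map_add, map_add, map_smul, smul_eq_mul] at h1
          rw [hπ (p i), map_add]
          linarith
        rw [← h0, zero_smul, add_zero, zero_mul]
        by_contra! hpos
        have h1 := hray ((s - g (π (p i)) + 1) / g (π.linear (y i).1))
          (div_nonneg (by linarith [hray 0 le_rfl]) hpos.le)
        rw [div_mul_cancel₀ _ hpos.ne'] at h1
        linarith
      · have h1 := hs i ((y i).2⁻¹ • (y i).1) (by
            have h2 := AffineSubspace.vadd_mem_of_mem_direction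
              ((A i).direction.smul_mem (y i).2⁻¹ (hyA i)) (hpA i)
            rw [smul_sub, smul_smul, inv_mul_cancel₀ h0.ne', one_smul, vadd_eq_add,
              sub_add_cancel] at h2
            exact h2)
          (fun a => by
            rw [map_smul, smul_eq_mul, inv_mul_le_iff₀ h0, mul_comm]
            exact hf a)
        rw [hπ, map_smul, map_add, map_smul, smul_eq_mul] at h1
        rw [map_add, map_smul, smul_eq_mul]
        calc g (π.linear (y i).1) + (y i).2 * g (π 0)
            = (y i).2 * ((y i).2⁻¹ * g (π.linear (y i).1) + g (π 0)) := by
              field_simp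
          _ ≤ (y i).2 * s := mul_le_mul_of_nonneg_left h1 h0.le
    calc ∑ i, g (π.linear (y i).1 + (y i).2 • π 0) ≤ ∑ i, (y i).2 * s :=
          Finset.sum_le_sum fun i _ => hterm i
      _ = s := by rw [← Finset.sum_mul, hy1, one_mul]

theorem IsPolyhedronOfSize.mono {ι : Type*} {Q : Set (ι → ℝ)} {m m' : ℕ}
    (h : IsPolyhedronOfSize Q m) (hm : m ≤ m') : IsPolyhedronOfSize Q m' := by
  obtain ⟨S, nh, hnh, f, b, rfl⟩ := h
  exact ⟨S, nh, hnh.trans hm, f, b, rfl⟩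

/-- The oscillation of a functional on `B` is controlled by the one on `C`. -/
theorem le_of_relDist_le {ι : Type*} {C B : Set (ι → ℝ)} {ε : ℝ} (hε : 0 ≤ ε)
    (h : relDist C B ≤ ENNReal.ofReal ε) (g : (ι → ℝ) →ₗ[ℝ] ℝ) {w s : ℝ} (hw : 0 ≤ w)
    (hC : ∀ a ∈ C, ∀ a' ∈ C, g a - g a' ≤ w) (hs : ∀ a ∈ C, g a ≤ s) {y y' : ι → ℝ}
    (hy : y ∈ B) (hy' : y' ∈ B) :
    g y ≤ s + ε * w ∧ g y - g y' ≤ w + 2 * (ε * w) := by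
  constructor
  · refine le_of_forall_pos_le_add fun η hη => ?_
    obtain ⟨a, ha, h1⟩ := exists_abs_sub_le_of_relDist_le hε h g hw hC hy hη
    linarith [hs a ha, (abs_le.mp h1).2]
  · refine le_of_forall_pos_le_add fun η hη => ?_
    obtain ⟨a, ha, h1⟩ := exists_abs_sub_le_of_relDist_le hε h g hw hC hy (half_pos hη)
    obtain ⟨a', ha', h2⟩ := exists_abs_sub_le_of_relDist_le hε h g hw hC hy' (half_pos hη)
    linarith [hC a ha a' ha', (abs_le.mp h1).2, (abs_le.mp h2).1]

/-- A mixed-integer formulation with `k` integer variables can be replaced by a linear one of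
slightly worse accuracy whose size grows by a factor of at most `(W + 1) ^ k`. -/
theorem IsMILEF.exists_isLEF {ι : Type*} {C : Set (ι → ℝ)} (hC : Convex ℝ C) (hne : C.Nonempty)
    {ε δ ε' t : ℝ} {m k W : ℕ} (hε : 0 ≤ ε) (h : IsMILEF C ε m k) (ht : 0 < t) (ht1 : t < 1 / 2)
    (hW : 4 * (k : ℝ) ^ 5 ≤ t * W) (hδ : t ≤ (1 - 2 * t) * δ)
    (hε' : ε + δ * (1 + 2 * ε) ≤ ε') :
    ∃ N : ℕ, N ≤ (W + 1) ^ k ∧ IsLEF C ε' (N * (m + 1)) := by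
  obtain ⟨l, Q, σ, π, hQ, hsub, hdist⟩ := h
  have hQc := hQ.convex
  obtain ⟨S, nh, hnh, f, b, rfl⟩ := hQ
  obtain ⟨𝓗, hcard, hcover, hctrl⟩ := exists_slices_cover hQc σ ht ht1 hW k le_rfl
    (AffineMap.id ℝ (Fin k → ℝ)) (fun w i => ⟨w i, rfl⟩)
  let e := 𝓗.equivFin.symm
  let A : Fin 𝓗.card → AffineSubspace ℝ (Fin l → ℝ) := fun i =>
    S ⊓ (e i : AffineSubspace ℝ _).comap σ
  have hA : ∀ i x, x ∈ A i ↔ x ∈ S ∧ σ x ∈ (e i : AffineSubspace ℝ (Fin k → ℝ)) :=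
    fun i x => Iff.rfl
  obtain ⟨l', R, ρ, hR, hin, hout⟩ := exists_union_extended_formulation A f b (fun i => by
    obtain ⟨x, hx, hxH⟩ := (hctrl _ (e i).2).1
    exact ⟨x, (hA i x).mpr ⟨hx.1, hxH⟩, hx.2⟩) π
  have hw0 : 0 ≤ δ := by
    by_contra! h0
    nlinarith
  have hsub' : C ⊆ ρ '' R := hsub.trans <| convexHull_min (by
    rintro _ ⟨x, ⟨hxQ, hxσ⟩, rfl⟩
    choose w hw using hxσ
    obtain ⟨H, hH, hxH⟩ := hcover x hxQ ⟨w, funext hw⟩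
    exact hin (e.symm ⟨H, hH⟩) x ((hA _ x).mpr ⟨hxQ.1, by simpa using hxH⟩) hxQ.2)
    (hR.convex.affine_image ρ)
  refine ⟨𝓗.card, hcard, l', R, ρ, hR.mono (by gcongr), hsub', ?_⟩
  have h0 : 0 ≤ ε' := le_trans (by positivity) hε'
  refine relDist_le_of_forall_le hC hne h0 fun g w s hw hgw hgs => hout g _ ?_
  intro i x hx hxf
  obtain ⟨hxS, hxσ⟩ := (hA i x).mp hx
  obtain ⟨z, hz, z', hz', hzl, hzl', hle⟩ :=
    (hctrl _ (e i).2).2 (g ∘ₗ π.linear) x ⟨hxS, hxf⟩ hxσ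
  obtain ⟨h1, h2⟩ := le_of_relDist_le hε hdist g hw hgw hgs
    (subset_convexHull ℝ _ ⟨z, ⟨hz, hzl⟩, rfl⟩) (subset_convexHull ℝ _ ⟨z', ⟨hz', hzl'⟩, rfl⟩)
  have hπ : ∀ x, g (π x) = (g ∘ₗ π.linear) x + g (π 0) := fun x => by
    rw [congrFun π.decomp x, Pi.add_apply, map_add, LinearMap.comp_apply]
  rw [hπ z] at h1
  rw [hπ z, hπ z'] at h2
  rw [hπ x]
  set u := (g ∘ₗ π.linear) x
  set v := (g ∘ₗ π.linear) z
  set v' := (g ∘ₗ π.linear) z'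
  have hpos : 0 < 1 - 2 * t := by linarith
  have hstep : u ≤ v + δ * (w + 2 * (ε * w)) := by
    have h3 : t * (v - v') ≤ (1 - 2 * t) * (δ * (w + 2 * (ε * w))) := by
      calc t * (v - v') ≤ t * (w + 2 * (ε * w)) := by gcongr; linarith
        _ ≤ ((1 - 2 * t) * δ) * (w + 2 * (ε * w)) := by gcongr
        _ = _ := by ring
    refine le_of_mul_le_mul_left ?_ hpos
    linarith
  have := mul_le_mul_of_nonneg_right hε' hw
  linarith

theorem IsMILEF.isLEF_of_zero {ι : Type*} {C : Set (ι → ℝ)} {ε ε' : ℝ} {m : ℕ}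
    (h : IsMILEF C ε m 0) (hε : ε ≤ ε') : IsLEF C ε' m := by
  obtain ⟨l, Q, σ, π, hQ, hsub, hdist⟩ := h
  have h1 : Q ∩ {x | IsLatticePoint (σ x)} = Q :=
    Set.inter_eq_left.mpr fun x _ i => i.elim0
  rw [h1, (hQ.convex.affine_image π).convexHull_eq] at hsub hdist
  exact ⟨l, Q, π, hQ, hsub, hdist.trans (ENNReal.ofReal_le_ofReal hε)⟩

/-- If `k log n` is small compared to `n`, then `(c n ^ q) ^ k` is at most `2 ^ (ε n)`. -/
theorem mul_rpow_pow_le {c q ε κ : ℝ} (hc : 1 ≤ c) (hq : 0 ≤ q)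
    (hκ : (Real.log c / Real.log 2 + q) * κ ≤ ε * Real.log 2) {n k : ℕ} (hn : 2 ≤ n)
    (hk : k * Real.log n ≤ κ * n) :
    (c * (n : ℝ) ^ q) ^ k ≤ (2 : ℝ) ^ (ε * n) := by
  have hn2 : (2 : ℝ) ≤ n := by exact_mod_cast hn
  have hlog2 : 0 < Real.log 2 := Real.log_pos one_lt_two
  have hlog : Real.log 2 ≤ Real.log n := Real.log_le_log two_pos hn2
  have hlogc : 0 ≤ Real.log c := Real.log_nonneg hc
  have h1 : Real.log c ≤ Real.log c / Real.log 2 * Real.log n := by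
    calc Real.log c = Real.log c / Real.log 2 * Real.log 2 := by field_simp
      _ ≤ _ := by gcongr
  have hpos : 0 < c * (n : ℝ) ^ q := by positivity
  rw [← Real.log_le_log_iff (by positivity) (by positivity), Real.log_pow,
    Real.log_mul (by positivity) (by positivity), Real.log_rpow (by positivity),
    Real.log_rpow two_pos]
  calc k * (Real.log c + q * Real.log n)
      ≤ k * (Real.log c / Real.log 2 * Real.log n + q * Real.log n) := by gcongr
    _ = (Real.log c / Real.log 2 + q) * (k * Real.log n) := by ring
    _ ≤ (Real.log c / Real.log 2 + q) * (κ * n) := by gcongr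
    _ = (Real.log c / Real.log 2 + q) * κ * n := by ring
    _ ≤ ε * Real.log 2 * n := by gcongr
    _ = ε * n * Real.log 2 := by ring

/-- Let `α, β, γ, ε > 0` with `ε < α` and `ε < γ`.  There is a constant
`κ > 0` such that for every `n ≥ 2`: if a non-empty convex set `C` does not admit an
`(α/n^β)`-LEF of size at most `2^(γ·n)`, then every `((α-ε)/n^β)`-MILEF of `C` of size at
most `2^((γ-ε)·n)` has at least `κ·n/log n` integer variables. -/
theorem milef_hardness_transfer (α β γ ε : ℝ)
    (hα : 0 < α) (hβ : 0 < β) (hγ : 0 < γ) (hε : 0 < ε) (hεα : ε < α) (hεγ : ε < γ) :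
    ∃ κ : ℝ, 0 < κ ∧
      ∀ n : ℕ, 2 ≤ n →
        ∀ (d : ℕ) (C : Set (Fin d → ℝ)), Convex ℝ C → C.Nonempty →
          (¬ ∃ m' : ℕ, (m' : ℝ) ≤ (2 : ℝ) ^ (γ * (n : ℝ)) ∧ IsLEF C (α / (n : ℝ) ^ β) m') →
          ∀ m k : ℕ, (m : ℝ) ≤ (2 : ℝ) ^ ((γ - ε) * (n : ℝ)) →
            IsMILEF C ((α - ε) / (n : ℝ) ^ β) m k →
            κ * (n : ℝ) / Real.log (n : ℝ) ≤ (k : ℝ) := by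
  set A := (1 + 2 * α) / ε with hA
  have hA0 : 0 < A := by positivity
  set c := 2 * (10 + 4 * A) with hc
  have hc1 : 1 ≤ c := by linarith
  have hlog2 : 0 < Real.log 2 := Real.log_pos one_lt_two
  have hq0 : 0 < Real.log c / Real.log 2 + (5 + β) := by
    have := Real.log_nonneg hc1
    positivity
  refine ⟨min (Real.log 2) (ε * Real.log 2 / (Real.log c / Real.log 2 + (5 + β))),
    by positivity, ?_⟩
  intro n hn d C hC hne hno m k hm hMI
  set κ := min (Real.log 2) (ε * Real.log 2 / (Real.log c / Real.log 2 + (5 + β))) with hκ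
  have hn2 : (2 : ℝ) ≤ n := by exact_mod_cast hn
  have hnlog : Real.log 2 ≤ Real.log n := Real.log_le_log two_pos hn2
  have hnβ : 1 ≤ (n : ℝ) ^ β := Real.one_le_rpow (by linarith) hβ.le
  by_contra! hlt
  rw [lt_div_iff₀ (by linarith)] at hlt
  rcases Nat.eq_zero_or_pos k with rfl | hk
  · exact hno ⟨m, hm.trans (Real.rpow_le_rpow_of_exponent_le one_le_two (by gcongr; linarith)),
      hMI.isLEF_of_zero (by gcongr; linarith)⟩
  have hk1 : (1 : ℝ) ≤ k := by exact_mod_cast hk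
  have hkn : (k : ℝ) ≤ n := by
    have h1 : κ * n ≤ Real.log 2 * n := by gcongr; exact min_le_left _ _
    have h2 : k * Real.log 2 ≤ k * Real.log n := by gcongr
    refine le_of_mul_le_mul_right ?_ hlog2
    linarith
  set ε₀ := (α - ε) / (n : ℝ) ^ β with hε₀
  have hε₀0 : 0 ≤ ε₀ := div_nonneg (by linarith) (by positivity)
  have hε₀α : ε₀ ≤ α := (div_le_self (by linarith) hnβ).trans (by linarith)
  set B := A * (n : ℝ) ^ β with hB
  have hB0 : 0 < B := by positivity
  set δ := B⁻¹ with hδ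
  set t := (2 + B)⁻¹ with ht
  have ht0 : 0 < t := by positivity
  have ht1 : t < 1 / 2 := by
    rw [ht, inv_lt_comm₀ (by positivity) (by positivity)]
    linarith
  set W := ⌈4 * (k : ℝ) ^ 5 * (2 + B)⌉₊ with hW
  have hWle : 4 * (k : ℝ) ^ 5 ≤ t * W := by
    rw [ht, inv_mul_eq_div, le_div_iff₀ (by positivity)]
    exact Nat.le_ceil _
  have htδ : t ≤ (1 - 2 * t) * δ := by
    apply le_of_eq
    rw [ht, hδ]
    field_simp
    ring
  have hεδ : ε₀ + δ * (1 + 2 * ε₀) ≤ α / (n : ℝ) ^ β := by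
    have h1 : δ * (1 + 2 * ε₀) ≤ δ * (1 + 2 * α) := by gcongr
    have h2 : δ * (1 + 2 * α) = ε / (n : ℝ) ^ β := by
      rw [hδ, hB, hA]
      field_simp
    have h3 : α / (n : ℝ) ^ β = ε₀ + ε / (n : ℝ) ^ β := by rw [hε₀]; ring
    linarith
  obtain ⟨N, hN, hLEF⟩ := hMI.exists_isLEF hC hne hε₀0 ht0 ht1 hWle htδ hεδ
  refine hno ⟨_, ?_, hLEF⟩
  have hpow : (n : ℝ) ^ (5 + β) = n ^ 5 * (n : ℝ) ^ β := by
    rw [Real.rpow_add (by positivity)]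
    norm_cast
  have hWn : 2 * ((W : ℝ) + 1) ≤ c * (n : ℝ) ^ (5 + β) := by
    have h1 : (W : ℝ) ≤ 4 * (k : ℝ) ^ 5 * (2 + B) + 1 := (Nat.ceil_lt_add_one (by positivity)).le
    have h2 : 4 * (k : ℝ) ^ 5 * (2 + B) ≤ 4 * (n : ℝ) ^ 5 * (2 * (n : ℝ) ^ β + B) := by
      gcongr
      linarith
    have h3 : 1 ≤ (n : ℝ) ^ 5 * (n : ℝ) ^ β :=
      one_le_mul_of_one_le_of_one_le (one_le_pow₀ (by linarith)) hnβ
    rw [hpow, hc]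
    calc 2 * ((W : ℝ) + 1) ≤ 2 * (4 * (n : ℝ) ^ 5 * (2 * (n : ℝ) ^ β + B) + 2) := by linarith
      _ = 2 * ((8 + 4 * A) * (n ^ 5 * (n : ℝ) ^ β) + 2) := by rw [hB]; ring
      _ ≤ _ := by linarith
  have hκε : (Real.log c / Real.log 2 + (5 + β)) * κ ≤ ε * Real.log 2 := by
    rw [mul_comm, ← le_div_iff₀ hq0]
    exact min_le_right _ _
  have hm1 : (m : ℝ) + 1 ≤ 2 * (2 : ℝ) ^ ((γ - ε) * (n : ℝ)) := by
    have := Real.one_le_rpow one_le_two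
      (mul_nonneg (sub_pos.mpr hεγ).le (by positivity : (0 : ℝ) ≤ n))
    linarith
  have hpow2 : 2 * ((W : ℝ) + 1) ^ k ≤ (2 : ℝ) ^ (ε * n) := by
    calc 2 * ((W : ℝ) + 1) ^ k ≤ 2 ^ k * ((W : ℝ) + 1) ^ k := by
          gcongr
          exact le_self_pow₀ one_le_two hk.ne'
      _ = (2 * ((W : ℝ) + 1)) ^ k := (mul_pow _ _ _).symm
      _ ≤ (c * (n : ℝ) ^ (5 + β)) ^ k := by gcongr
      _ ≤ _ := mul_rpow_pow_le hc1 (by positivity) hκε hn hlt.le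
  push_cast
  calc (N : ℝ) * (m + 1) ≤ ((W : ℝ) + 1) ^ k * (2 * (2 : ℝ) ^ ((γ - ε) * (n : ℝ))) := by
        gcongr
        exact_mod_cast hN
    _ = 2 * ((W : ℝ) + 1) ^ k * (2 : ℝ) ^ ((γ - ε) * (n : ℝ)) := by ring
    _ ≤ (2 : ℝ) ^ (ε * n) * (2 : ℝ) ^ ((γ - ε) * (n : ℝ)) := by gcongr
    _ = (2 : ℝ) ^ (γ * (n : ℝ)) := by
        rw [← Real.rpow_add two_pos]
        congr 1
        ring
end

section
/- Let P ⊆ ℝ^d and P' ⊆ ℝ^{d'} be non-empty polyhedra such that P' is the image under an affine map of a face of P. If P admits an exact MILEF of complexity (m,k), then P' also admits an exact MILEF of complexity (m,k). -/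
open scoped ENNReal Pointwise

/-- `P` admits an exact MILEF of complexity `(m, k)`:
`P = conv(π(Q ∩ σ⁻¹(ℤ^k)))` for some polyhedron `Q` with at most `m` facets. -/
def IsExactMILEF {ι : Type*} (P : Set (ι → ℝ)) (m k : ℕ) : Prop :=
  ∃ (l : ℕ) (Q : Set (Fin l → ℝ)) (σ : (Fin l → ℝ) →ᵃ[ℝ] (Fin k → ℝ))
    (π : (Fin l → ℝ) →ᵃ[ℝ] (ι → ℝ)),
    IsPolyhedronOfSize Q m ∧
    P = convexHull ℝ (π '' (Q ∩ {x | IsLatticePoint (σ x)}))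

/-- A face of a convex hull is the convex hull of the generators lying on the face. -/
theorem convexHull_inter_zero_of_nonneg {E : Type*} [AddCommGroup E] [Module ℝ E]
    (X : Set E) (φ : E →ᵃ[ℝ] ℝ) (hφ : ∀ x ∈ X, 0 ≤ φ x) :
    convexHull ℝ X ∩ {x | φ x = 0} = convexHull ℝ (X ∩ {x | φ x = 0}) := by
  apply Set.Subset.antisymm
  · have hconv : Convex ℝ {x | 0 ≤ φ x ∧ (φ x = 0 → x ∈ convexHull ℝ (X ∩ {x | φ x = 0}))} := by
      rintro x ⟨hx, hx0⟩ y ⟨hy, hy0⟩ a b ha hb hab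
      have hcomb : φ (a • x + b • y) = a * φ x + b * φ y := by
        simpa using Convex.combo_affine_apply (f := φ) (x := x) (y := y) hab
      have hax := mul_nonneg ha hx
      have hby := mul_nonneg hb hy
      refine ⟨hcomb ▸ add_nonneg hax hby, fun h0 => ?_⟩
      rw [hcomb, add_eq_zero_iff_of_nonneg hax hby, mul_eq_zero, mul_eq_zero] at h0
      obtain ⟨rfl | hx', rfl | hy'⟩ := h0
      · simp at hab
      · obtain rfl : b = 1 := by simpa using hab
        simpa using hy0 hy'
      · obtain rfl : a = 1 := by simpa using hab
        simpa using hx0 hx'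
      · exact convex_convexHull ℝ _ (hx0 hx') (hy0 hy') ha hb hab
    rintro x ⟨hx, hx0⟩
    refine (convexHull_min ?_ hconv hx).2 hx0
    exact fun y hy => ⟨hφ y hy, fun h0 => subset_convexHull ℝ _ ⟨hy, h0⟩⟩
  · refine Set.subset_inter (convexHull_mono Set.inter_subset_left) ?_
    have hzero : Convex ℝ {x | φ x = 0} := (convex_singleton (0 : ℝ)).affine_preimage φ
    exact convexHull_min Set.inter_subset_right hzero

/-- Intersecting a polyhedron with a hyperplane does not increase its size. -/
theorem IsPolyhedronOfSize.inter_zero {ι : Type*} {Q : Set (ι → ℝ)} {m : ℕ}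
    (hQ : IsPolyhedronOfSize Q m) (ψ : (ι → ℝ) →ᵃ[ℝ] ℝ) :
    IsPolyhedronOfSize (Q ∩ {x | ψ x = 0}) m := by
  obtain ⟨S, nh, hnh, f, b, rfl⟩ := hQ
  refine ⟨S ⊓ (AffineSubspace.mk' (0 : ℝ) ⊥).comap ψ, nh, hnh, f, b, ?_⟩
  ext x
  simp [and_right_comm, AffineSubspace.mem_inf_iff, AffineSubspace.mem_comap]

/-- If `P' ⊆ ℝ^{d'}` is the image under an affine map of a face of the
non-empty polyhedron `P ⊆ ℝ^d`, and `P` admits an exact MILEF of complexity `(m,k)`, then so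
does `P'`.  A face of `P` is a set `P ∩ φ⁻¹(0)` where `φ` is affine with `φ(P) ⊆ ℝ_{≥0}`. -/
theorem exactMILEF_of_face_projection (d d' : ℕ)
    (P : Set (Fin d → ℝ)) (P' : Set (Fin d' → ℝ))
    (hP : IsPolyhedron P) (hP' : IsPolyhedron P')
    (hPne : P.Nonempty) (hP'ne : P'.Nonempty)
    (φ : (Fin d → ℝ) →ᵃ[ℝ] ℝ) (hφ : ∀ x ∈ P, 0 ≤ φ x)
    (τ : (Fin d → ℝ) →ᵃ[ℝ] (Fin d' → ℝ))
    (hface : P' = τ '' (P ∩ {x | φ x = 0}))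
    (m k : ℕ) (h : IsExactMILEF P m k) :
    IsExactMILEF P' m k := by
  obtain ⟨l, Q, σ, π, hQ, rfl⟩ := h
  refine ⟨l, Q ∩ {x | φ.comp π x = 0}, σ, τ.comp π, hQ.inter_zero (φ.comp π), ?_⟩
  rw [hface, convexHull_inter_zero_of_nonneg _ _ fun x hx => hφ x (subset_convexHull ℝ _ hx),
    AffineMap.image_convexHull, AffineMap.coe_comp, Set.image_comp,
    Set.image_inter_preimage π _ {x | φ x = 0} |>.symm, Set.inter_right_comm]
  rfl
end
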